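/- Let u^{(k)} ∈ L^∞(ℝⁿ×(0,T); ℝⁿ) be a sequence of mild solutions of the Navier–Stokes equations with initial data u₀^{(k)} ∈ L^∞(ℝⁿ;ℝⁿ), and assume ‖u^{(k)}‖_{L^∞(ℝⁿ×(0,T))} ≤ C with C independent of k. Then there is a subsequence of (u^{(k)}) that converges locally uniformly in ℝⁿ×(0,T) to a mild solution u ∈ L^∞(ℝⁿ×(0,T); ℝⁿ) whose initial datum is the weak-* limit in L^∞(ℝⁿ) of the corresponding subsequence of (u₀^{(k)}). -/

import Mathlib

open MeasureTheory Real Filter Topology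

noncomputable section

/-- Euclidean space ℝⁿ. -/
abbrev Euc (n : ℕ) := EuclideanSpace ℝ (Fin n)

/-- The heat kernel Γ(x,t) = (4πt)^{-n/2} exp(-|x|²/(4t)). -/
noncomputable def heatKer (n : ℕ) (x : Euc n) (t : ℝ) : ℝ :=
  (4 * π * t) ^ (-(n : ℝ) / 2) * Real.exp (-‖x‖ ^ 2 / (4 * t))

/-- The fundamental solution G of the Laplacian on ℝⁿ (n ≥ 2). -/
noncomputable def lapFund (n : ℕ) (x : Euc n) : ℝ :=
  if n = 2 then (2 * π)⁻¹ * Real.log ‖x‖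
  else -((((n : ℝ) - 2) * (2 * π ^ ((n : ℝ) / 2) / Real.Gamma ((n : ℝ) / 2)))⁻¹) *
      ‖x‖ ^ (2 - (n : ℝ))

/-- The generating function Φ(x,t) = ∫_{ℝⁿ} G(y) Γ(x-y,t) dy. -/
noncomputable def genPhi (n : ℕ) (x : Euc n) (t : ℝ) : ℝ :=
  ∫ y : Euc n, lapFund n y * heatKer n (x - y) t

/-- Spatial partial derivative ∂f/∂x_i of a scalar function on ℝⁿ. -/
noncomputable def pd (n : ℕ) (i : Fin n) (f : Euc n → ℝ) (x : Euc n) : ℝ :=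
  fderiv ℝ f x (EuclideanSpace.single i 1)

/-- The Laplacian of a scalar function on ℝⁿ. -/
noncomputable def lap (n : ℕ) (f : Euc n → ℝ) (x : Euc n) : ℝ :=
  ∑ i : Fin n, pd n i (pd n i f) x

/-- The Oseen kernel K_{ij} = (-δ_{ij}Δ + ∂²/∂x_i∂x_j)Φ. -/
noncomputable def Kmat (n : ℕ) (i j : Fin n) (x : Euc n) (t : ℝ) : ℝ :=
  (if i = j then -(lap n (fun y => genPhi n y t) x) else 0)
    + pd n i (pd n j (fun y => genPhi n y t)) x

/-- The kernel K_{ijk} = ∂K_{ij}/∂x_k. -/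
noncomputable def Kten (n : ℕ) (i j k : Fin n) (x : Euc n) (t : ℝ) : ℝ :=
  pd n k (fun y => Kmat n i j y t) x

/-- Mild solution of the Navier–Stokes equations on ℝⁿ × (t₀,t₁) with initial datum u₀:
u_i(x,t) = ∫ Γ(x-y,t-t₀) u₀ᵢ(y) dy - ∫_{t₀}^t ∫ K_{ijk}(x-y,t-s) u_k u_j dy ds. -/
def IsMildNS (n : ℕ) (t₀ t₁ : ℝ) (u₀ : Euc n → Euc n) (u : Euc n → ℝ → Euc n) : Prop :=
  ∀ x : Euc n, ∀ t : ℝ, t ∈ Set.Ioo t₀ t₁ → ∀ i : Fin n,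
    u x t i = (∫ y : Euc n, heatKer n (x - y) (t - t₀) * u₀ y i)
      - ∫ s in Set.Ioo t₀ t, ∫ y : Euc n,
          ∑ j : Fin n, ∑ k : Fin n, Kten n i j k (x - y) (t - s) * u y s k * u y s j

/-- Spatial partial derivative for functions on space-time ℝⁿ × ℝ. -/
noncomputable def pdx (n : ℕ) (i : Fin n) (g : Euc n × ℝ → ℝ) (p : Euc n × ℝ) : ℝ :=
  fderiv ℝ g p (EuclideanSpace.single i 1, 0)

/-- Time derivative for functions on space-time ℝⁿ × ℝ. -/
noncomputable def pdt (n : ℕ) (g : Euc n × ℝ → ℝ) (p : Euc n × ℝ) : ℝ :=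
  fderiv ℝ g p (0, 1)

/-- Spatial Laplacian for functions on space-time ℝⁿ × ℝ. -/
noncomputable def lapx (n : ℕ) (g : Euc n × ℝ → ℝ) (p : Euc n × ℝ) : ℝ :=
  ∑ i : Fin n, pdx n i (pdx n i g) p

section Duality

variable {α : Type*} [MeasurableSpace α] {μ : Measure α}

/-- A bounded measurable function acts on `L¹` as a continuous linear functional, with operator
norm at most any constant for which the `L¹` bound holds. -/
theorem exists_clm_integral_mul {f : α → ℝ} (hf : AEStronglyMeasurable f μ) {B C : ℝ}
    (hB : ∀ x, ‖f x‖ ≤ B) (hC : 0 ≤ C)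
    (h : ∀ g : α → ℝ, Integrable g μ → |∫ x, g x * f x ∂μ| ≤ C * ∫ x, ‖g x‖ ∂μ) :
    ∃ ℓ : Lp ℝ 1 μ →L[ℝ] ℝ, ‖ℓ‖ ≤ C ∧
      ∀ (g : α → ℝ) (hg : Integrable g μ), ℓ hg.toL1 = ∫ x, g x * f x ∂μ := by
  have hint : ∀ g : α → ℝ, Integrable g μ → Integrable (fun x => g x * f x) μ := fun g hg =>
    hg.mul_bdd hf (ae_of_all _ hB)
  let ℓ₀ : Lp ℝ 1 μ →ₗ[ℝ] ℝ :=
    { toFun := fun g => ∫ x, g x * f x ∂μ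
      map_add' := by
        intro g₁ g₂
        rw [← integral_add (hint _ (L1.integrable_coeFn g₁)) (hint _ (L1.integrable_coeFn g₂))]
        refine integral_congr_ae ?_
        filter_upwards [Lp.coeFn_add g₁ g₂] with x hx
        rw [hx, Pi.add_apply, add_mul]
      map_smul' := by
        intro c g
        rw [RingHom.id_apply, smul_eq_mul, ← integral_const_mul]
        refine integral_congr_ae ?_
        filter_upwards [Lp.coeFn_smul c g] with x hx
        rw [hx, Pi.smul_apply, smul_eq_mul, mul_assoc] }
  refine ⟨ℓ₀.mkContinuous C ?_, LinearMap.mkContinuous_norm_le _ hC _, ?_⟩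
  · intro g
    rw [L1.norm_eq_integral_norm]
    exact h _ (L1.integrable_coeFn g)
  · intro g hg
    refine integral_congr_ae ?_
    filter_upwards [hg.coeFn_toL1] with x hx
    rw [hx]

/-- Sequential Banach–Alaoglu for finite families of functionals. -/
theorem exists_subseq_tendsto_dual {E ι : Type*} [NormedAddCommGroup E] [NormedSpace ℝ E]
    [TopologicalSpace.SeparableSpace E] [Fintype ι] (ℓ : ℕ → ι → (E →L[ℝ] ℝ)) {C : ℝ} (hC : 0 ≤ C)
    (h : ∀ m i, ‖ℓ m i‖ ≤ C) :
    ∃ φ : ℕ → ℕ, StrictMono φ ∧ ∃ L : ι → (E →L[ℝ] ℝ), (∀ i, ‖L i‖ ≤ C) ∧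
      ∀ i g, Tendsto (fun m => ℓ (φ m) i g) atTop (𝓝 (L i g)) := by
  classical
  have hF : ∀ m, StrongDual.toWeakDual (∑ i, (ℓ m i).comp (ContinuousLinearMap.proj i)) ∈
      (WeakDual.toStrongDual ⁻¹' Metric.closedBall (0 : StrongDual ℝ (ι → E))
        (Fintype.card ι * C)) := by
    intro m
    simp only [Set.mem_preimage, mem_closedBall_zero_iff]
    refine ContinuousLinearMap.opNorm_le_bound _ (by positivity) fun x => ?_
    have : (WeakDual.toStrongDual (StrongDual.toWeakDual
      (∑ i, (ℓ m i).comp (ContinuousLinearMap.proj i)))) x = ∑ i, ℓ m i (x i) := by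
      change (∑ i, (ℓ m i).comp (ContinuousLinearMap.proj i)) x = _
      simp
    rw [this]
    refine (norm_sum_le _ _).trans ?_
    have : ∀ i ∈ (Finset.univ : Finset ι), ‖ℓ m i (x i)‖ ≤ C * ‖x‖ := fun i _ =>
      ((ℓ m i).le_of_opNorm_le (h m i) _).trans (by gcongr; exact norm_le_pi_norm x i)
    refine (Finset.sum_le_sum this).trans (by simp [mul_assoc])
  obtain ⟨L, -, φ, hφ, hL⟩ := WeakDual.isSeqCompact_closedBall ℝ (ι → E) 0 _ hF
  have hlim : ∀ i g, Tendsto (fun m => ℓ (φ m) i g) atTop (𝓝 (L (Pi.single i g))) := by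
    intro i g
    have := ((WeakDual.eval_continuous (𝕜 := ℝ) (Pi.single i g : ι → E)).tendsto L).comp hL
    refine this.congr fun m => ?_
    change (∑ i, (ℓ (φ m) i).comp (ContinuousLinearMap.proj i)) (Pi.single i g) = _
    rw [sum_apply, Finset.sum_eq_single i]
    · simp
    · intro j _ hj
      simp [Pi.single_eq_of_ne hj]
    · simp
  refine ⟨φ, hφ, fun i => (WeakDual.toStrongDual L).comp (ContinuousLinearMap.single ℝ (fun _ : ι => E) i),
    fun i => ContinuousLinearMap.opNorm_le_bound _ hC fun g => ?_, fun i g => hlim i g⟩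
  exact le_of_tendsto (hlim i g).norm
    (Eventually.of_forall fun m => (ℓ (φ m) i).le_of_opNorm_le (h _ _) _)

theorem abs_integral_mul_le {f g : α → ℝ} {C : ℝ} (hC : ∀ x, |f x| ≤ C) (hg : Integrable g μ) :
    |∫ x, g x * f x ∂μ| ≤ C * ∫ x, ‖g x‖ ∂μ := by
  rw [← integral_const_mul]
  refine (norm_integral_le_of_norm_le (G := ℝ) (hg.norm.const_mul C) (ae_of_all _ fun x => ?_))
  rw [norm_mul, mul_comm]
  exact mul_le_mul_of_nonneg_right (hC x) (norm_nonneg _)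

/-- A norm-bounded, pointwise convergent sequence of functionals converges locally uniformly along
continuous families of vectors. -/
theorem tendstoLocallyUniformlyOn_dual_comp {E X : Type*} [NormedAddCommGroup E] [NormedSpace ℝ E]
    [TopologicalSpace X] {ℓ : ℕ → (E →L[ℝ] ℝ)} {L : E →L[ℝ] ℝ} {C : ℝ}
    (hℓ : ∀ m, ‖ℓ m‖ ≤ C) (hL : ‖L‖ ≤ C) (h : ∀ g, Tendsto (fun m => ℓ m g) atTop (𝓝 (L g)))
    {a : X → E} {s : Set X} (ha : ContinuousOn a s) :
    TendstoLocallyUniformlyOn (fun m q => ℓ m (a q)) (fun q => L (a q)) atTop s := by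
  have hC : 0 ≤ C := (norm_nonneg _).trans hL
  rw [Metric.tendstoLocallyUniformlyOn_iff]
  intro ε hε q hq
  have hδ : 0 < ε / (3 * (C + 1)) := by positivity
  refine ⟨_, Metric.continuousWithinAt_iff'.1 (ha q hq) _ hδ, ?_⟩
  filter_upwards [Metric.tendsto_nhds.1 (h (a q)) (ε / 3) (by positivity)] with m hm y hy
  have hy' : C * ‖a y - a q‖ < ε / 3 := by
    rw [dist_eq_norm, lt_div_iff₀ (by positivity)] at hy
    nlinarith [norm_nonneg (a y - a q)]
  have h1 := (ℓ m).le_of_opNorm_le (hℓ m) (a y - a q)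
  have h2 := L.le_of_opNorm_le hL (a y - a q)
  rw [map_sub, Real.norm_eq_abs] at h1 h2
  rw [Real.dist_eq] at hm ⊢
  have := abs_le.1 (h1.trans hy'.le)
  have := abs_le.1 (h2.trans hy'.le)
  have := abs_lt.1 hm
  have h1' := abs_le.1 h1
  have h2' := abs_le.1 h2
  rw [abs_lt]
  constructor <;> linarith

/-- Representation of functionals on `L¹` by bounded functions, given a positive weight in `L²`. -/
theorem exists_bdd_repr_dual_L1 (L : Lp ℝ 1 μ →L[ℝ] ℝ) {C : ℝ} (hL : ‖L‖ ≤ C) {r : α → ℝ}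
    (hr : MemLp r 2 μ) (hrm : Measurable r) (hr0 : ∀ x, 0 < r x) :
    ∃ v : α → ℝ, Measurable v ∧ (∀ x, |v x| ≤ C) ∧
      ∀ (g : α → ℝ) (hg : Integrable g μ), L hg.toL1 = ∫ x, g x * v x ∂μ := by
  have hC : 0 ≤ C := (norm_nonneg _).trans hL
  let T : Lp ℝ 2 μ →L[ℝ] Lp ℝ 1 μ :=
    (ContinuousLinearMap.mul ℝ ℝ).holderL μ 2 2 1 (hr.toLp r)
  let V : Lp ℝ 2 μ := (InnerProductSpace.toDual ℝ (Lp ℝ 2 μ)).symm (L.comp T)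
  have hV : ∀ (h : α → ℝ) (hh : MemLp h 2 μ) (hi : Integrable (fun x => r x * h x) μ),
      L hi.toL1 = ∫ x, V x * h x ∂μ := by
    intro h hh hi
    have h1 : L (T (hh.toLp h)) = inner ℝ V (hh.toLp h) := by
      simp [V, InnerProductSpace.toDual_symm_apply]
    have h2 : T (hh.toLp h) = hi.toL1 := by
      refine Lp.ext ?_
      filter_upwards [(ContinuousLinearMap.mul ℝ ℝ).coeFn_holder (r := 1) (hr.toLp r) (hh.toLp h),
        hr.coeFn_toLp, hh.coeFn_toLp, hi.coeFn_toL1] with x e1 e2 e3 e4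
      rw [e4]
      exact e1.trans (by simp [e2, e3])
    rw [← h2, h1, L2.inner_def]
    refine integral_congr_ae ?_
    filter_upwards [hh.coeFn_toLp] with x e3
    simp [e3, mul_comm]
  have hVm : MemLp (fun x => V x) 2 μ := Lp.memLp V
  have hrr : Integrable (fun x => r x * r x) μ := hr.integrable_mul hr
  have hVr : Integrable (fun x => V x * r x) μ := hVm.integrable_mul hr
  have hset : ∀ s, MeasurableSet s → |∫ x in s, V x * r x ∂μ| ≤ ∫ x in s, C * (r x * r x) ∂μ := by
    intro s hs
    have hi : Integrable (fun x => r x * s.indicator r x) μ := by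
      refine (hrr.indicator hs).congr (ae_of_all _ fun x => ?_)
      by_cases hx : x ∈ s <;> simp [hx]
    have e := hV (s.indicator r) (hr.indicator hs) hi
    have e2 : ∫ x, V x * s.indicator r x ∂μ = ∫ x in s, V x * r x ∂μ := by
      rw [← integral_indicator hs]
      refine integral_congr_ae (ae_of_all _ fun x => ?_)
      by_cases hx : x ∈ s <;> simp [hx]
    rw [← e2, ← e, ← Real.norm_eq_abs]
    refine (L.le_of_opNorm_le hL _).trans ?_
    rw [L1.norm_of_fun_eq_integral_norm, integral_const_mul]
    refine le_of_eq ?_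
    congr 1
    rw [← integral_indicator hs]
    refine integral_congr_ae (ae_of_all _ fun x => ?_)
    by_cases hx : x ∈ s <;> simp [hx]
  have hle1 := ae_le_of_forall_setIntegral_le hVr (hrr.const_mul C) fun s hs _ =>
    (abs_le.1 (hset s hs)).2
  have hle2 := ae_le_of_forall_setIntegral_le (hrr.const_mul C).neg hVr fun s hs _ => by
    have := (abs_le.1 (hset s hs)).1
    simpa [integral_neg] using this
  have hVle : ∀ᵐ x ∂μ, |V x / r x| ≤ C := by
    filter_upwards [hle1, hle2] with x h1 h2
    rw [Pi.neg_apply] at h2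
    rw [abs_div, abs_of_pos (hr0 x), div_le_iff₀ (hr0 x), abs_le]
    constructor <;> nlinarith [hr0 x]
  let v : α → ℝ := fun x => max (-C) (min C (V x / r x))
  have hvm : Measurable v :=
    measurable_const.max (measurable_const.min ((Lp.stronglyMeasurable V).measurable.div hrm))
  have hvC : ∀ x, |v x| ≤ C := fun x => abs_le.2
    ⟨le_max_left _ _, max_le (by linarith) (min_le_left _ _)⟩
  have hveq : ∀ᵐ x ∂μ, v x * r x = V x := by
    filter_upwards [hVle] with x hx
    have := abs_le.1 hx
    have : v x = V x / r x := by simp only [v]; rw [min_eq_right this.2, max_eq_right this.1]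
    rw [this, div_mul_cancel₀ _ (hr0 x).ne']
  refine ⟨v, hvm, hvC, fun g hg => ?_⟩
  obtain ⟨ℓ, -, hℓ⟩ := exists_clm_integral_mul hvm.aestronglyMeasurable hvC hC
    fun g hg => abs_integral_mul_le (μ := μ) hvC hg
  wlog hgm : StronglyMeasurable g generalizing g
  · have hgi : Integrable (hg.1.mk g) μ := hg.congr hg.1.ae_eq_mk
    have := this _ hgi hg.1.stronglyMeasurable_mk
    rw [(Integrable.toL1_eq_toL1_iff g (hg.1.mk g) hg hgi).2 hg.1.ae_eq_mk, this]
    exact integral_congr_ae (hg.1.ae_eq_mk.mono fun x hx => by simp only [hx])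
  rw [← hℓ g hg]
  let S : ℕ → Set α := fun N => {x | |g x| ≤ N * (r x * r x)}
  have hS : ∀ N, MeasurableSet (S N) := fun N =>
    measurableSet_le hgm.measurable.abs ((hrm.mul hrm).const_mul _)
  let gN : ℕ → α → ℝ := fun N => (S N).indicator g
  have hgN : ∀ N, Integrable (gN N) μ := fun N => hg.indicator (hS N)
  have heq : ∀ N, L (hgN N).toL1 = ℓ (hgN N).toL1 := by
    intro N
    have hh : MemLp (fun x => gN N x / r x) 2 μ := by
      refine (hr.const_mul N).of_le
        (by simpa only [div_eq_mul_inv] using! (hgN N).1.mul hrm.inv.aestronglyMeasurable) (ae_of_all _ fun x => ?_)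
      rw [norm_div, Real.norm_of_nonneg (hr0 x).le, div_le_iff₀ (hr0 x), norm_mul,
        Real.norm_of_nonneg (hr0 x).le, RCLike.norm_natCast]
      by_cases hx : x ∈ S N
      · have : |g x| ≤ N * (r x * r x) := hx
        simp only [gN, Set.indicator_of_mem hx, Real.norm_eq_abs]
        linarith
      · have := hr0 x
        simp only [gN, Set.indicator_of_notMem hx, norm_zero]
        positivity
    have hrw : ∀ x, r x * (gN N x / r x) = gN N x := fun x =>
      mul_div_cancel₀ _ (hr0 x).ne'
    have hi : Integrable (fun x => r x * (gN N x / r x)) μ := by simpa only [hrw] using hgN N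
    have e1 := hV _ hh hi
    have e2 : hi.toL1 = (hgN N).toL1 := by
      rw [Integrable.toL1_eq_toL1_iff]
      exact ae_of_all _ hrw
    rw [← e2, e1, e2, hℓ]
    refine integral_congr_ae ?_
    filter_upwards [hveq] with x hx
    rw [← hx]
    have := (hr0 x).ne'
    field_simp
  have hlim : Tendsto (fun N => (hgN N).toL1) atTop (𝓝 hg.toL1) := by
    rw [tendsto_iff_dist_tendsto_zero]
    have hd : ∀ N, dist (hgN N).toL1 hg.toL1 = ∫ x, ‖gN N x - g x‖ ∂μ := by
      intro N
      rw [dist_eq_norm, ← Integrable.toL1_sub, L1.norm_of_fun_eq_integral_norm]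
      rfl
    simp only [hd]
    rw [← integral_zero α ℝ (μ := μ)]
    refine tendsto_integral_of_dominated_convergence (fun x => ‖g x‖)
      (fun N => ((hgN N).sub hg).1.norm) hg.norm (fun N => ae_of_all _ fun x => ?_)
      (ae_of_all _ fun x => ?_)
    · by_cases hx : x ∈ S N <;> simp [gN, hx]
    · refine tendsto_const_nhds.congr' ?_
      obtain ⟨N₀, hN₀⟩ := exists_nat_ge (|g x| / (r x * r x))
      filter_upwards [eventually_ge_atTop N₀] with N hN
      have hx : x ∈ S N := by
        have h0 := hr0 x
        rw [div_le_iff₀ (by positivity)] at hN₀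
        refine hN₀.trans ?_
        gcongr
      simp [gN, hx]
  exact tendsto_nhds_unique ((L.continuous.tendsto _).comp hlim)
    (((ℓ.continuous.tendsto _).comp hlim).congr fun N => (heq N).symm)

end Duality

/-- Translations act continuously in `L¹`. -/
theorem continuous_toL1_comp_sub_left {X : Type*} [NormedAddCommGroup X] [MeasurableSpace X]
    [BorelSpace X] [SecondCountableTopology X] [LocallyCompactSpace X] {μ : Measure X}
    [μ.IsAddHaarMeasure] {K : X → ℝ} (hK : Integrable K μ) :
    Continuous fun q : X => (hK.comp_sub_left q).toL1 := by
  have hg : Continuous fun q : X => (⟨fun y => q - y, by fun_prop⟩ : C(X, X)) :=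
    ContinuousMap.continuous_of_continuous_uncurry _ (by
      simp only [Function.uncurry_def, ContinuousMap.coe_mk]; fun_prop)
  exact (continuous_const (y := hK.toL1)).compMeasurePreservingLp hg
    (fun q => Measure.measurePreserving_sub_left μ q) ENNReal.one_ne_top

section HeatKernel

variable {n : ℕ}

/-- The normalizing factor of the heat kernel. -/
def gaussWeight (n : ℕ) (s : ℝ) : ℝ := (4 * π * s) ^ (-(n : ℝ) / 2)

theorem gaussWeight_pos {s : ℝ} (hs : 0 < s) : 0 < gaussWeight n s := by
  unfold gaussWeight; positivity

theorem measurable_gaussWeight : Measurable (gaussWeight n) := by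
  unfold gaussWeight; fun_prop

theorem heatKer_eq (x : Euc n) (s : ℝ) :
    heatKer n x s = gaussWeight n s * exp (-(‖x‖ ^ 2 / (4 * s))) := by
  rw [heatKer, gaussWeight, neg_div (4 * s) (‖x‖ ^ 2)]

theorem heatKer_pos (x : Euc n) {s : ℝ} (hs : 0 < s) : 0 < heatKer n x s := by
  rw [heatKer_eq]; exact mul_pos (gaussWeight_pos hs) (exp_pos _)

theorem measurable_heatKer : Measurable fun p : Euc n × ℝ => heatKer n p.1 p.2 := by
  unfold heatKer; fun_prop

theorem continuous_heatKer (s : ℝ) : Continuous fun x : Euc n => heatKer n x s := by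
  unfold heatKer; fun_prop

theorem integral_heatKer {s : ℝ} (hs : 0 < s) : ∫ x : Euc n, heatKer n x s = 1 := by
  have h := GaussianFourier.integral_rexp_neg_mul_sq_norm (V := Euc n) (b := (4 * s)⁻¹)
    (by positivity)
  simp only [heatKer_eq, integral_const_mul]
  have e : ∀ x : Euc n, -(‖x‖ ^ 2 / (4 * s)) = -(4 * s)⁻¹ * ‖x‖ ^ 2 := fun x => by ring
  simp only [e, h, gaussWeight, finrank_euclideanSpace, Fintype.card_fin]
  rw [show π / (4 * s)⁻¹ = 4 * π * s by field_simp, ← rpow_add (by positivity)]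
  rw [show -(n : ℝ) / 2 + n / 2 = 0 by ring, rpow_zero]

theorem integrable_heatKer {s : ℝ} (hs : 0 < s) : Integrable fun x : Euc n => heatKer n x s :=
  integrable_of_integral_eq_one (integral_heatKer hs)

theorem integral_heatKer_sub {s : ℝ} (hs : 0 < s) (x : Euc n) :
    ∫ y : Euc n, heatKer n (x - y) s = 1 := by
  rw [integral_sub_left_eq_self (fun y => heatKer n y s), integral_heatKer hs]

theorem integrable_heatKer_sub {s : ℝ} (hs : 0 < s) (x : Euc n) :
    Integrable fun y : Euc n => heatKer n (x - y) s :=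
  (integrable_heatKer hs).comp_sub_left x

theorem heatKer_mul_heatKer_sub {s t : ℝ} (hs : 0 < s) (ht : 0 < t) (x y : Euc n) :
    heatKer n y s * heatKer n (x - y) t =
      heatKer n x (s + t) * heatKer n ((s / (s + t)) • x - y) (s * t / (s + t)) := by
  have hst : 0 < s + t := by positivity
  simp only [heatKer_eq]
  have e1 : gaussWeight n s * gaussWeight n t =
      gaussWeight n (s + t) * gaussWeight n (s * t / (s + t)) := by
    simp only [gaussWeight]
    rw [← mul_rpow (by positivity) (by positivity), ← mul_rpow (by positivity) (by positivity)]
    congr 1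
    field_simp
  have e2 : exp (-(‖y‖ ^ 2 / (4 * s))) * exp (-(‖x - y‖ ^ 2 / (4 * t))) =
      exp (-(‖x‖ ^ 2 / (4 * (s + t)))) *
        exp (-(‖(s / (s + t)) • x - y‖ ^ 2 / (4 * (s * t / (s + t))))) := by
    rw [← exp_add, ← exp_add]
    congr 1
    rw [norm_sub_sq_real, norm_sub_sq_real, norm_smul, inner_smul_left,
      Real.norm_of_nonneg (by positivity)]
    simp only [conj_trivial]
    field_simp
    ring
  calc _ = (gaussWeight n s * gaussWeight n t) *
        (exp (-(‖y‖ ^ 2 / (4 * s))) * exp (-(‖x - y‖ ^ 2 / (4 * t)))) := by ring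
    _ = _ := by rw [e1, e2]; ring

theorem integrable_heatKer_mul {s t : ℝ} (hs : 0 < s) (ht : 0 < t) (x : Euc n) :
    Integrable fun y : Euc n => heatKer n y s * heatKer n (x - y) t := by
  simp only [heatKer_mul_heatKer_sub hs ht]
  exact (integrable_heatKer_sub (by positivity) _).const_mul _

/-- The semigroup property of the heat kernel. -/
theorem integral_heatKer_mul {s t : ℝ} (hs : 0 < s) (ht : 0 < t) (x : Euc n) :
    ∫ y : Euc n, heatKer n y s * heatKer n (x - y) t = heatKer n x (s + t) := by
  simp only [heatKer_mul_heatKer_sub hs ht]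
  rw [integral_const_mul, integral_heatKer_sub (by positivity), mul_one]

theorem integrable_norm_sq_mul_heatKer_sub {t : ℝ} (ht : 0 < t) (x : Euc n) :
    Integrable fun y : Euc n => ‖y‖ ^ 2 * heatKer n (x - y) t := by
  have hbd : ∀ y : Euc n, ‖y‖ ^ 2 * heatKer n (x - y) t ≤
      ((2 * ‖x‖ ^ 2 + 16 * t) * (gaussWeight n t / gaussWeight n (2 * t))) *
        heatKer n (x - y) (2 * t) := by
    intro y
    have h0 := gaussWeight_pos (n := n) ht
    have h1 := gaussWeight_pos (n := n) (s := 2 * t) (by positivity)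
    have e1 : heatKer n (x - y) t = gaussWeight n t * (exp (-(‖x - y‖ ^ 2 / (8 * t))) *
        exp (-(‖x - y‖ ^ 2 / (8 * t)))) := by
      rw [heatKer_eq, ← exp_add]; congr 2; field_simp; ring
    have e2 : heatKer n (x - y) (2 * t) = gaussWeight n (2 * t) *
        exp (-(‖x - y‖ ^ 2 / (8 * t))) := by
      rw [heatKer_eq]; congr 4; ring
    have hy : ‖y‖ ^ 2 ≤ 2 * ‖x‖ ^ 2 + 2 * ‖x - y‖ ^ 2 := by
      have : ‖y‖ ≤ ‖x‖ + ‖x - y‖ := by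
        have := norm_sub_le x (x - y); rwa [sub_sub_cancel] at this
      nlinarith [norm_nonneg y, sq_nonneg (‖x‖ - ‖x - y‖)]
    set z := ‖x - y‖ ^ 2 / (8 * t) with hz
    have hz0 : 0 ≤ z := by positivity
    have hzz : ‖x - y‖ ^ 2 = 8 * t * z := by rw [hz]; field_simp
    have hze : z * exp (-z) ≤ 1 := by
      rw [exp_neg, ← div_eq_mul_inv, div_le_one (exp_pos _)]
      linarith [add_one_le_exp z]
    have hle1 : exp (-z) ≤ 1 := exp_le_one_iff.2 (by linarith)
    have hkey : ‖y‖ ^ 2 * exp (-z) ≤ 2 * ‖x‖ ^ 2 + 16 * t := by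
      calc _ ≤ (2 * ‖x‖ ^ 2 + 2 * ‖x - y‖ ^ 2) * exp (-z) := by gcongr
        _ = 2 * ‖x‖ ^ 2 * exp (-z) + 16 * t * (z * exp (-z)) := by rw [hzz]; ring
        _ ≤ 2 * ‖x‖ ^ 2 * 1 + 16 * t * 1 := by gcongr
        _ = _ := by ring
    rw [e1, e2]
    calc _ = (‖y‖ ^ 2 * exp (-z)) * (gaussWeight n t * exp (-z)) := by ring
      _ ≤ (2 * ‖x‖ ^ 2 + 16 * t) * (gaussWeight n t * exp (-z)) := by gcongr
      _ = _ := by field_simp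
  refine ((integrable_heatKer_sub (show 0 < 2 * t by positivity) x).const_mul
    ((2 * ‖x‖ ^ 2 + 16 * t) * (gaussWeight n t / gaussWeight n (2 * t)))).mono' ?_ (ae_of_all _ fun y => ?_)
  · exact (Continuous.mul (by fun_prop)
      ((continuous_heatKer t).comp (by fun_prop))).aestronglyMeasurable
  · rw [Real.norm_of_nonneg (mul_nonneg (sq_nonneg _) (heatKer_pos _ ht).le)]
    exact hbd y

end HeatKernel

section TimeIntegrals

theorem abs_exp_neg_sub_exp_neg_le {a b m : ℝ} (ha : m ≤ a) (hb : m ≤ b) :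
    |exp (-a) - exp (-b)| ≤ |a - b| * exp (-m) := by
  wlog hab : a ≤ b generalizing a b
  · rw [abs_sub_comm, abs_sub_comm a]
    exact this hb ha (le_of_not_ge hab)
  have h1 : exp (-b) = exp (-a) * exp (a - b) := by rw [← exp_add]; congr 1; ring
  have h2 := add_one_le_exp (a - b)
  have h3 : exp (-a) ≤ exp (-m) := exp_le_exp.2 (by linarith)
  have h4 : exp (-b) ≤ exp (-a) := exp_le_exp.2 (by linarith)
  rw [abs_of_nonneg (by linarith), abs_of_nonpos (by linarith), h1]
  nlinarith [exp_pos (-a), exp_pos (-m)]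

/-- Differentiation of Laplace-type integrals with respect to the squared radius. -/
theorem hasDerivAt_integral_exp_neg_div {S : Set ℝ} (hS : MeasurableSet S) (hS0 : S ⊆ Set.Ioi 0)
    {w c : ℝ → ℝ} (hw : Measurable w) (hc : Measurable c) {ρ ε : ℝ} (hε : 0 < ε)
    (hi : IntegrableOn (fun s => w s * (exp (-(ρ / (4 * s))) - c s)) S)
    (hb : IntegrableOn (fun s => (4 * s)⁻¹ * w s * exp (-((ρ - ε) / (4 * s)))) S) :
    HasDerivAt (fun r => ∫ s in S, w s * (exp (-(r / (4 * s))) - c s))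
      (-∫ s in S, (4 * s)⁻¹ * w s * exp (-(ρ / (4 * s)))) ρ := by
  rw [← integral_neg]
  have key := hasDerivAt_integral_of_dominated_loc_of_deriv_le (μ := volume.restrict S)
    (F := fun r s => w s * (exp (-(r / (4 * s))) - c s))
    (F' := fun r s => -((4 * s)⁻¹ * w s * exp (-(r / (4 * s))))) (x₀ := ρ)
    (bound := fun s => ‖(4 * s)⁻¹ * w s * exp (-((ρ - ε) / (4 * s)))‖)
    (Ioo_mem_nhds (show ρ - ε < ρ by linarith) (show ρ < ρ + ε by linarith))
    (Eventually.of_forall fun r => by fun_prop) hi (by fun_prop) ?_ hb.norm ?_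
  · exact key.2
  · refine (ae_restrict_iff' hS).2 (ae_of_all _ fun s hs r hr => ?_)
    have hs0 : 0 < s := hS0 hs
    rw [norm_neg, norm_mul, norm_mul _ (exp _), Real.norm_of_nonneg (exp_pos _).le,
      Real.norm_of_nonneg (exp_pos _).le]
    gcongr
    exact hr.1.le
  · refine (ae_restrict_iff' hS).2 (ae_of_all _ fun s hs r hr => ?_)
    have hs0 : 0 < s := hS0 hs
    have h1 : HasDerivAt (fun r : ℝ => -(r / (4 * s))) (-(1 / (4 * s))) r :=
      ((hasDerivAt_id r).div_const _).neg
    refine ((h1.exp.sub_const (c s)).const_mul (w s)).congr_deriv ?_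
    ring

variable {n : ℕ}

theorem gaussWeight_eq {s : ℝ} (hs : 0 < s) :
    gaussWeight n s = (4 * π) ^ (-(n : ℝ) / 2) * s ^ (-(n : ℝ) / 2) := by
  rw [gaussWeight, mul_rpow (by positivity) hs.le]

theorem integrableOn_Ioi_pow_inv_mul_gaussWeight (hn : 2 ≤ n) {t : ℝ} (ht : 0 < t) {m : ℕ}
    (hm : 1 ≤ m) (ρ : ℝ) :
    IntegrableOn (fun s => ((4 * s)⁻¹ ^ m * gaussWeight n s) * exp (-(ρ / (4 * s))))
      (Set.Ioi t) := by
  have h := (integrableOn_Ioi_rpow_of_lt (a := -(m : ℝ) + -(n : ℝ) / 2) (c := t) (by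
    have : (1 : ℝ) ≤ m := by exact_mod_cast hm
    have : (2 : ℝ) ≤ n := by exact_mod_cast hn
    linarith) ht).const_mul (4⁻¹ ^ m * (4 * π) ^ (-(n : ℝ) / 2) * exp (|ρ| / (4 * t)))
  refine h.mono' ?_ ((ae_restrict_iff' measurableSet_Ioi).2 (ae_of_all _ fun s hs => ?_))
  · exact (((by fun_prop : Measurable fun s : ℝ => (4 * s)⁻¹ ^ m).mul measurable_gaussWeight).mul
      (by fun_prop)).aestronglyMeasurable
  · have hs0 : 0 < s := ht.trans hs
    have hle : exp (-(ρ / (4 * s))) ≤ exp (|ρ| / (4 * t)) := by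
      refine exp_le_exp.2 ?_
      rw [← neg_div]
      calc -ρ / (4 * s) ≤ |ρ| / (4 * s) := by gcongr; exact neg_le_abs ρ
        _ ≤ _ := by gcongr; exact le_of_lt hs
    have h0 := gaussWeight_pos (n := n) hs0
    rw [Real.norm_of_nonneg (by positivity)]
    have e : (4 * s)⁻¹ ^ m * gaussWeight n s =
        4⁻¹ ^ m * (4 * π) ^ (-(n : ℝ) / 2) * s ^ (-(m : ℝ) + -(n : ℝ) / 2) := by
      rw [gaussWeight_eq hs0, rpow_add hs0, rpow_neg hs0.le, rpow_natCast, mul_inv, mul_pow,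
        inv_pow s]
      ring
    calc _ ≤ (4 * s)⁻¹ ^ m * gaussWeight n s * exp (|ρ| / (4 * t)) := by gcongr
      _ = _ := by rw [e]; ring

theorem integrableOn_and_integral_inv_mul_gaussWeight (hn : 2 ≤ n) {ρ : ℝ} (hρ : 0 < ρ) :
    IntegrableOn (fun s => (4 * s)⁻¹ * gaussWeight n s * exp (-(ρ / (4 * s)))) (Set.Ioi 0) ∧
      ∫ s in Set.Ioi 0, (4 * s)⁻¹ * gaussWeight n s * exp (-(ρ / (4 * s))) =
        4⁻¹ * (π ^ (-(n : ℝ) / 2) * Gamma (n / 2)) * ρ ^ (-(n : ℝ) / 2) := by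
  have hn' : (0 : ℝ) < n / 2 := by positivity
  let g : ℝ → ℝ := fun r => r ^ ((n : ℝ) / 2 - 1) * exp (-((ρ / 4) * r))
  have hg : IntegrableOn g (Set.Ioi 0) := by
    have := integrableOn_rpow_mul_exp_neg_mul_rpow (p := 1) (s := (n : ℝ) / 2 - 1) (b := ρ / 4)
      (by linarith) (by norm_num) (by positivity)
    simpa only [rpow_one, neg_mul] using this
  have hgi : ∫ r in Set.Ioi 0, g r = (1 / (ρ / 4)) ^ ((n : ℝ) / 2) * Gamma (n / 2) :=
    Real.integral_rpow_mul_exp_neg_mul_Ioi hn' (by positivity)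
  have e : ∀ s ∈ Set.Ioi (0 : ℝ), (4⁻¹ * (4 * π) ^ (-(n : ℝ) / 2)) •
      ((|(-1 : ℝ)| * s ^ ((-1 : ℝ) - 1)) • g (s ^ (-1 : ℝ))) =
        (4 * s)⁻¹ * gaussWeight n s * exp (-(ρ / (4 * s))) := by
    intro s hs
    have hs0 : (0 : ℝ) < s := hs
    simp only [g, smul_eq_mul, abs_neg, abs_one, one_mul]
    rw [← rpow_mul hs0.le, gaussWeight_eq hs0]
    rw [show -1 * ((n : ℝ) / 2 - 1) = 1 + -(n : ℝ) / 2 by ring, rpow_add hs0, rpow_one,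
      show (-1 : ℝ) - 1 = ((-2 : ℤ) : ℝ) by norm_num, rpow_intCast, rpow_neg_one,
      show -(ρ / 4 * s⁻¹) = -(ρ / (4 * s)) by field_simp]
    have : s ^ (-2 : ℤ) = s⁻¹ * s⁻¹ := by
      rw [zpow_neg]; norm_cast; rw [pow_two, mul_inv]
    rw [this]
    field_simp
  have hint := ((integrableOn_Ioi_comp_rpow_iff g (p := -1) (by norm_num)).2 hg).smul
    (4⁻¹ * (4 * π) ^ (-(n : ℝ) / 2))
  refine ⟨IntegrableOn.congr_fun hint e measurableSet_Ioi, ?_⟩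
  rw [← setIntegral_congr_fun measurableSet_Ioi e, integral_smul,
    integral_comp_rpow_Ioi g (p := -1) (by norm_num), hgi, smul_eq_mul,
    mul_rpow (by norm_num) pi_pos.le, one_div, inv_div, div_rpow (by norm_num) hρ.le,
    neg_div, rpow_neg hρ.le, rpow_neg (by norm_num : (0 : ℝ) ≤ 4)]
  have : (0 : ℝ) < 4 ^ ((n : ℝ) / 2) := by positivity
  field_simp

theorem integrableOn_gaussWeight_mul_exp_sub (hn : 2 ≤ n) {ρ : ℝ} (hρ : 0 < ρ) :
    IntegrableOn (fun s => gaussWeight n s * (exp (-(ρ / (4 * s))) - exp (-(1 / (4 * s)))))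
      (Set.Ioi 0) := by
  have hm : 0 < min ρ 1 := lt_min hρ one_pos
  refine ((integrableOn_and_integral_inv_mul_gaussWeight hn hm).1.const_mul |ρ - 1|).mono' ?_
    ((ae_restrict_iff' measurableSet_Ioi).2 (ae_of_all _ fun s hs => ?_))
  · exact (measurable_gaussWeight.mul (by fun_prop)).aestronglyMeasurable
  · have hs0 : (0 : ℝ) < s := hs
    have h0 := gaussWeight_pos (n := n) hs0
    rw [norm_mul, Real.norm_of_nonneg h0.le, Real.norm_eq_abs]
    have h := abs_exp_neg_sub_exp_neg_le (a := ρ / (4 * s)) (b := 1 / (4 * s))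
      (m := min ρ 1 / (4 * s)) (by gcongr; exact min_le_left _ _) (by gcongr; exact min_le_right _ _)
    rw [← sub_div, abs_div, abs_of_pos (show 0 < 4 * s by positivity)] at h
    calc _ ≤ gaussWeight n s * (|ρ - 1| / (4 * s) * exp (-(min ρ 1 / (4 * s)))) := by gcongr
      _ = _ := by field_simp

/-- The heat-kernel representation of the fundamental solution, up to an additive constant. -/
theorem exists_lapFund_eq (hn : 2 ≤ n) : ∃ c : ℝ, ∀ y : Euc n, y ≠ 0 →
    lapFund n y = c - ∫ s in Set.Ioi 0,
      gaussWeight n s * (exp (-(‖y‖ ^ 2 / (4 * s))) - exp (-(1 / (4 * s)))) := by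
  let A : ℝ := 4⁻¹ * (π ^ (-(n : ℝ) / 2) * Gamma (n / 2))
  let Ψ : ℝ → ℝ := fun ρ => ∫ s in Set.Ioi 0,
      gaussWeight n s * (exp (-(ρ / (4 * s))) - exp (-(1 / (4 * s))))
  have hΨ : ∀ ρ ∈ Set.Ioi (0 : ℝ), HasDerivAt Ψ (-(A * ρ ^ (-(n : ℝ) / 2))) ρ := by
    intro ρ hρ
    have hρ0 : (0 : ℝ) < ρ := hρ
    have h := hasDerivAt_integral_exp_neg_div measurableSet_Ioi (subset_refl (Set.Ioi (0 : ℝ)))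
      (measurable_gaussWeight (n := n)) (c := fun s => exp (-(1 / (4 * s)))) (by fun_prop)
      (half_pos hρ0) (integrableOn_gaussWeight_mul_exp_sub hn hρ0)
      (integrableOn_and_integral_inv_mul_gaussWeight hn (by linarith)).1
    rwa [(integrableOn_and_integral_inv_mul_gaussWeight hn hρ0).2] at h
  let R : ℝ → ℝ := fun ρ => if n = 2 then (4 * π)⁻¹ * Real.log ρ
    else -((((n : ℝ) - 2) * (2 * π ^ ((n : ℝ) / 2) / Real.Gamma ((n : ℝ) / 2)))⁻¹) *
      ρ ^ (1 - (n : ℝ) / 2)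
  have hR : ∀ ρ ∈ Set.Ioi (0 : ℝ), HasDerivAt R (A * ρ ^ (-(n : ℝ) / 2)) ρ := by
    intro ρ hρ
    have hρ0 : (0 : ℝ) < ρ := hρ
    by_cases h2 : n = 2
    · simp only [R, if_pos h2]
      refine ((Real.hasDerivAt_log hρ0.ne').const_mul _).congr_deriv ?_
      simp only [A, h2]
      norm_num
      rw [rpow_neg_one, rpow_neg_one]
      field_simp
    · simp only [R, if_neg h2]
      refine ((Real.hasDerivAt_rpow_const (p := 1 - (n : ℝ) / 2) (Or.inl hρ0.ne')).const_mul
        _).congr_deriv ?_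
      have hn3 : (0 : ℝ) < n - 2 := by
        have : (2 : ℝ) < n := by exact_mod_cast lt_of_le_of_ne hn (Ne.symm h2)
        linarith
      have hG : 0 < Gamma ((n : ℝ) / 2) := Gamma_pos_of_pos (by positivity)
      simp only [A]
      rw [show 1 - (n : ℝ) / 2 - 1 = -(n : ℝ) / 2 by ring, neg_div, rpow_neg pi_pos.le]
      have : 0 < π ^ ((n : ℝ) / 2) := by positivity
      field_simp
      ring
  have hder : ∀ ρ ∈ Set.Ioi (0 : ℝ), HasDerivAt (fun ρ => R ρ + Ψ ρ) 0 ρ := fun ρ hρ =>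
    ((hR ρ hρ).add (hΨ ρ hρ)).congr_deriv (by ring)
  obtain ⟨c, hc⟩ := isOpen_Ioi.exists_is_const_of_deriv_eq_zero isPreconnected_Ioi
    (fun ρ hρ => (hder ρ hρ).differentiableAt.differentiableWithinAt)
    (fun ρ hρ => (hder ρ hρ).deriv)
  refine ⟨c, fun y hy => ?_⟩
  have hy0 : 0 < ‖y‖ := norm_pos_iff.2 hy
  have h1 : R (‖y‖ ^ 2) = lapFund n y := by
    simp only [R, lapFund]
    split_ifs with h2
    · rw [Real.log_pow]
      push_cast
      field_simp
      norm_num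
    · congr 1
      rw [← rpow_natCast, ← rpow_mul hy0.le]
      congr 1
      push_cast
      ring
  have := hc (‖y‖ ^ 2) (pow_pos hy0 2)
  rw [← h1, ← this]
  simp only [Ψ]
  ring

end TimeIntegrals

section GeneratingFunction

variable {n : ℕ}

theorem gaussWeight_anti {s t : ℝ} (hs : 0 < s) (hst : s ≤ t) : gaussWeight n t ≤ gaussWeight n s :=
  rpow_le_rpow_of_nonpos (by positivity) (by gcongr) (by
    have : (0 : ℝ) ≤ n := n.cast_nonneg
    linarith)

theorem integrable_heatKer_mul_prod {t : ℝ} (ht : 0 < t) (x : Euc n) :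
    Integrable (fun p : Euc n × ℝ => heatKer n p.1 p.2 * heatKer n (x - p.1) t)
      (volume.prod (volume.restrict (Set.Ioc 0 1))) := by
  have hm : Measurable fun p : Euc n × ℝ => heatKer n p.1 p.2 * heatKer n (x - p.1) t :=
    measurable_heatKer.mul (((continuous_heatKer t).measurable).comp (by fun_prop))
  refine (integrable_prod_iff' hm.aestronglyMeasurable).2 ⟨?_, ?_⟩
  · exact (ae_restrict_iff' measurableSet_Ioc).2 (ae_of_all _ fun s hs =>
      integrable_heatKer_mul hs.1 ht x)
  · have e : ∀ s ∈ Set.Ioc (0 : ℝ) 1, heatKer n x (s + t) =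
        ∫ y : Euc n, ‖heatKer n y s * heatKer n (x - y) t‖ := by
      intro s hs
      rw [← integral_heatKer_mul hs.1 ht x]
      refine integral_congr_ae (ae_of_all _ fun y => ?_)
      exact (Real.norm_of_nonneg (mul_pos (heatKer_pos _ hs.1) (heatKer_pos _ ht)).le).symm
    refine IntegrableOn.congr_fun ?_ e measurableSet_Ioc
    refine Measure.integrableOn_of_bounded (M := gaussWeight n t) (by simp) ?_ ?_
    · exact (measurable_heatKer.comp (f := fun s : ℝ => (x, s + t)) (by fun_prop)).aestronglyMeasurable
    · refine (ae_restrict_iff' measurableSet_Ioc).2 (ae_of_all _ fun s hs => ?_)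
      have hst : 0 < s + t := add_pos hs.1 ht
      rw [Real.norm_of_nonneg (heatKer_pos _ hst).le, heatKer_eq]
      calc _ ≤ gaussWeight n t * 1 := by
            gcongr
            · exact (gaussWeight_pos ht).le
            · exact gaussWeight_anti ht (by linarith [hs.1])
            · exact exp_le_one_iff.2 (by have : 0 ≤ ‖x‖ ^ 2 / (4 * (s + t)) := by positivity
                                         linarith)
        _ = _ := mul_one _

theorem integrable_fund_mul_heatKer_prod (hn : 2 ≤ n) {t : ℝ} (ht : 0 < t) (x : Euc n) :
    Integrable (fun p : Euc n × ℝ => gaussWeight n p.2 *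
        (exp (-(‖p.1‖ ^ 2 / (4 * p.2))) - exp (-(1 / (4 * p.2)))) * heatKer n (x - p.1) t)
      (volume.prod (volume.restrict (Set.Ioi 0))) := by
  have hU : Set.Ioi (0 : ℝ) = Set.Ioc 0 1 ∪ Set.Ioi 1 :=
    (Set.Ioc_union_Ioi_eq_Ioi zero_le_one).symm
  have hker : Measurable fun y : Euc n => heatKer n (x - y) t :=
    (continuous_heatKer t).measurable.comp (by fun_prop)
  rw [hU, Measure.restrict_union Set.Ioc_disjoint_Ioi_same measurableSet_Ioi,
    Measure.prod_add]
  refine Integrable.add_measure ?_ ?_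
  · have h1 : IntegrableOn (fun s => gaussWeight n s * exp (-(1 / (4 * s)))) (Set.Ioc 0 1) := by
      refine (((integrableOn_and_integral_inv_mul_gaussWeight hn one_pos).1.mono_set
        Set.Ioc_subset_Ioi_self).const_mul 4).mono' ?_
        ((ae_restrict_iff' measurableSet_Ioc).2 (ae_of_all _ fun s hs => ?_))
      · exact (measurable_gaussWeight.mul (by fun_prop)).aestronglyMeasurable
      · have h0 := gaussWeight_pos (n := n) hs.1
        have hs0 := hs.1
        rw [Real.norm_of_nonneg (by positivity)]
        have : (1 : ℝ) ≤ 4 * (4 * s)⁻¹ := by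
          rw [← div_eq_mul_inv, le_div_iff₀ (by positivity)]
          linarith [hs.2]
        calc _ = 1 * (gaussWeight n s * exp (-(1 / (4 * s)))) := (one_mul _).symm
          _ ≤ (4 * (4 * s)⁻¹) * (gaussWeight n s * exp (-(1 / (4 * s)))) := by gcongr
          _ = _ := by ring
    refine ((integrable_heatKer_mul_prod ht x).sub
      ((integrable_heatKer_sub ht x).mul_prod h1)).congr (ae_of_all _ fun p => ?_)
    simp only [Pi.sub_apply, heatKer_eq p.1]
    ring
  · have h1 : IntegrableOn (fun s => (4 * s)⁻¹ * gaussWeight n s) (Set.Ioi 1) := by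
      simpa using integrableOn_Ioi_pow_inv_mul_gaussWeight hn one_pos le_rfl 0
    have h2 : Integrable fun y : Euc n => (‖y‖ ^ 2 + 1) * heatKer n (x - y) t := by
      simp only [add_mul, one_mul]
      exact (integrable_norm_sq_mul_heatKer_sub ht x).add (integrable_heatKer_sub ht x)
    refine (h2.mul_prod h1).mono' ?_ ?_
    · exact (((measurable_gaussWeight.comp measurable_snd).mul (by fun_prop)).mul
        (hker.comp measurable_fst)).aestronglyMeasurable
    · have hae : ∀ᵐ p ∂((volume : Measure (Euc n)).prod
          ((volume : Measure ℝ).restrict (Set.Ioi 1))), p.2 ∈ Set.Ioi (1 : ℝ) :=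
        Measure.quasiMeasurePreserving_snd.ae (ae_restrict_mem measurableSet_Ioi)
      filter_upwards [hae] with p hp
      have hs : 0 < p.2 := one_pos.trans hp
      have h0 := gaussWeight_pos (n := n) hs
      have hk := heatKer_pos (x - p.1) ht
      have h := abs_exp_neg_sub_exp_neg_le (a := ‖p.1‖ ^ 2 / (4 * p.2)) (b := 1 / (4 * p.2))
        (m := 0) (by positivity) (by positivity)
      rw [← sub_div, abs_div, abs_of_pos (show 0 < 4 * p.2 by positivity), neg_zero, exp_zero,
        mul_one] at h
      have h3 : |‖p.1‖ ^ 2 - 1| ≤ ‖p.1‖ ^ 2 + 1 := by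
        rw [abs_le]; constructor <;> linarith [sq_nonneg ‖p.1‖]
      rw [norm_mul, norm_mul, Real.norm_of_nonneg h0.le, Real.norm_of_nonneg hk.le,
        Real.norm_eq_abs]
      calc _ ≤ gaussWeight n p.2 * ((‖p.1‖ ^ 2 + 1) / (4 * p.2)) * heatKer n (x - p.1) t := by
            gcongr
            exact h.trans (by gcongr)
        _ = _ := by rw [div_eq_mul_inv]; ring

/-- The generating function as a time integral of the heat kernel. -/
theorem genPhi_eq (hn : 2 ≤ n) {t : ℝ} (ht : 0 < t) (x : Euc n) :
    IntegrableOn (fun s => gaussWeight n s * (exp (-(‖x‖ ^ 2 / (4 * s))) - 1)) (Set.Ioi t) ∧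
    genPhi n x t = genPhi n 0 t -
      ∫ s in Set.Ioi t, gaussWeight n s * (exp (-(‖x‖ ^ 2 / (4 * s))) - 1) := by
  obtain ⟨c, hc⟩ := exists_lapFund_eq hn
  have : Nontrivial (Euc n) := by
    have : Nonempty (Fin n) := ⟨⟨0, by omega⟩⟩
    infer_instance
  let k : ℝ → ℝ := fun s => gaussWeight n s * exp (-(1 / (4 * s)))
  have key : ∀ x : Euc n, IntegrableOn (fun s => heatKer n x (s + t) - k s) (Set.Ioi 0) ∧
      genPhi n x t = c - ∫ s in Set.Ioi 0, (heatKer n x (s + t) - k s) := by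
    intro x
    have hP := integrable_fund_mul_heatKer_prod hn ht x
    have hinner : ∀ s ∈ Set.Ioi (0 : ℝ), ∫ y : Euc n, gaussWeight n s *
        (exp (-(‖y‖ ^ 2 / (4 * s))) - exp (-(1 / (4 * s)))) * heatKer n (x - y) t =
          heatKer n x (s + t) - k s := by
      intro s hs
      have e : ∀ y : Euc n, gaussWeight n s *
          (exp (-(‖y‖ ^ 2 / (4 * s))) - exp (-(1 / (4 * s)))) * heatKer n (x - y) t =
          heatKer n y s * heatKer n (x - y) t - k s * heatKer n (x - y) t := fun y => by
        simp only [heatKer_eq y, k]; ring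
      simp only [e]
      rw [integral_sub (integrable_heatKer_mul hs ht x)
        ((integrable_heatKer_sub ht x).const_mul _), integral_heatKer_mul hs ht,
        integral_const_mul, integral_heatKer_sub ht, mul_one]
    refine ⟨IntegrableOn.congr_fun hP.integral_prod_right hinner measurableSet_Ioi, ?_⟩
    have h0 : ∀ᵐ y : Euc n, y ≠ 0 := by
      simp [ae_iff]
    have hL : ∀ᵐ y : Euc n, lapFund n y * heatKer n (x - y) t = c * heatKer n (x - y) t -
        ∫ s in Set.Ioi 0, gaussWeight n s *
          (exp (-(‖y‖ ^ 2 / (4 * s))) - exp (-(1 / (4 * s)))) * heatKer n (x - y) t := by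
      filter_upwards [h0] with y hy
      rw [hc y hy, sub_mul, integral_mul_const]
    rw [genPhi, integral_congr_ae hL, integral_sub ((integrable_heatKer_sub ht x).const_mul _)
      hP.integral_prod_left, integral_const_mul, integral_heatKer_sub ht, mul_one,
      integral_integral_swap hP, setIntegral_congr_fun measurableSet_Ioi hinner]
  obtain ⟨hx1, hx2⟩ := key x
  obtain ⟨hz1, hz2⟩ := key 0
  have hsub : ∀ s, (heatKer n x (s + t) - k s) - (heatKer n 0 (s + t) - k s) =
      gaussWeight n (s + t) * (exp (-(‖x‖ ^ 2 / (4 * (s + t)))) - 1) := fun s => by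
    simp only [heatKer_eq]
    simp
    ring
  have hpre : (fun s : ℝ => s + t) ⁻¹' Set.Ioi t = Set.Ioi 0 := by ext; simp
  have hmp := measurePreserving_add_right (volume : Measure ℝ) t
  have hme := (Homeomorph.addRight t).measurableEmbedding
  have hi : IntegrableOn ((fun s => gaussWeight n s * (exp (-(‖x‖ ^ 2 / (4 * s))) - 1)) ∘
      fun s => s + t) (Set.Ioi 0) :=
    (hx1.sub hz1).congr (ae_of_all _ hsub)
  rw [← hpre] at hi
  refine ⟨(hmp.integrableOn_comp_preimage hme).1 hi, ?_⟩
  rw [← hmp.setIntegral_preimage_emb hme, hpre, hx2, hz2, ← integral_congr_ae (ae_of_all _ hsub),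
    integral_sub hx1 hz1]
  ring

end GeneratingFunction

section OseenKernel

variable {n : ℕ}

/-- The radial profiles out of which the derivatives of the generating function are built. -/
def oseenJ (n m : ℕ) (ρ t : ℝ) : ℝ :=
  ∫ s in Set.Ioi t, ((4 * s)⁻¹ ^ m * gaussWeight n s) * exp (-(ρ / (4 * s)))

theorem hasDerivAt_oseenJ (hn : 2 ≤ n) {t : ℝ} (ht : 0 < t) {m : ℕ} (hm : 1 ≤ m) (ρ : ℝ) :
    HasDerivAt (fun r => oseenJ n m r t) (-oseenJ n (m + 1) ρ t) ρ := by
  have h := hasDerivAt_integral_exp_neg_div (S := Set.Ioi t) measurableSet_Ioi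
    (Set.Ioi_subset_Ioi ht.le) (w := fun s => (4 * s)⁻¹ ^ m * gaussWeight n s) (c := fun _ => 0)
    (Measurable.mul (by fun_prop) measurable_gaussWeight) measurable_const (ρ := ρ) one_pos
    (by simpa using integrableOn_Ioi_pow_inv_mul_gaussWeight hn ht hm ρ)
    (by simpa [pow_succ', mul_assoc] using
      integrableOn_Ioi_pow_inv_mul_gaussWeight hn ht (m := m + 1) (by omega) (ρ - 1))
  simpa [oseenJ, pow_succ', mul_assoc] using h

theorem hasFDerivAt_comp_norm_sq {f : ℝ → ℝ} {f' : ℝ} {x : Euc n}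
    (h : HasDerivAt f f' (‖x‖ ^ 2)) :
    HasFDerivAt (fun y : Euc n => f (‖y‖ ^ 2)) (f' • ((2 : ℝ) • innerSL ℝ x)) x := by
  have h1 : HasFDerivAt (fun y : Euc n => ‖y‖ ^ 2) ((2 : ℝ) • innerSL ℝ x) x := by
    simpa [two_smul] using (hasStrictFDerivAt_norm_sq x).hasFDerivAt
  exact h.comp_hasFDerivAt x h1

theorem hasFDerivAt_oseenJ (hn : 2 ≤ n) {t : ℝ} (ht : 0 < t) {m : ℕ} (hm : 1 ≤ m) (x : Euc n) :
    HasFDerivAt (fun y : Euc n => oseenJ n m (‖y‖ ^ 2) t)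
      ((-oseenJ n (m + 1) (‖x‖ ^ 2) t) • ((2 : ℝ) • innerSL ℝ x)) x :=
  hasFDerivAt_comp_norm_sq (hasDerivAt_oseenJ hn ht hm _)

theorem hasFDerivAt_coord (j : Fin n) (x : Euc n) :
    HasFDerivAt (fun y : Euc n => y j) (EuclideanSpace.proj j : Euc n →L[ℝ] ℝ) x :=
  (EuclideanSpace.proj j : Euc n →L[ℝ] ℝ).hasFDerivAt

theorem pd_eq_of_hasFDerivAt {f : Euc n → ℝ} {f' : Euc n →L[ℝ] ℝ} {x : Euc n}
    (h : HasFDerivAt f f' x) (i : Fin n) : pd n i f x = f' (EuclideanSpace.single i 1) := by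
  rw [pd, h.fderiv]

theorem pd_genPhi (hn : 2 ≤ n) {t : ℝ} (ht : 0 < t) (j : Fin n) (x : Euc n) :
    pd n j (fun y => genPhi n y t) x = 2 * x j * oseenJ n 1 (‖x‖ ^ 2) t := by
  have hd := hasDerivAt_integral_exp_neg_div (S := Set.Ioi t) measurableSet_Ioi
    (Set.Ioi_subset_Ioi ht.le) (w := gaussWeight n) (c := fun _ => 1)
    measurable_gaussWeight measurable_const (ρ := ‖x‖ ^ 2) one_pos
    (genPhi_eq hn ht x).1
    (by simpa using integrableOn_Ioi_pow_inv_mul_gaussWeight hn ht le_rfl (‖x‖ ^ 2 - 1))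
  have h := (hasFDerivAt_comp_norm_sq hd).const_sub (genPhi n 0 t)
  rw [← funext fun y => (genPhi_eq hn ht y).2] at h
  rw [pd_eq_of_hasFDerivAt h]
  simp [oseenJ, EuclideanSpace.inner_single_right]
  ring

theorem pd_pd_genPhi (hn : 2 ≤ n) {t : ℝ} (ht : 0 < t) (i j : Fin n) (x : Euc n) :
    pd n i (pd n j (fun y => genPhi n y t)) x =
      2 * (if i = j then 1 else 0) * oseenJ n 1 (‖x‖ ^ 2) t
        - 4 * x i * x j * oseenJ n 2 (‖x‖ ^ 2) t := by
  rw [funext fun y => pd_genPhi hn ht j y]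
  refine (pd_eq_of_hasFDerivAt
    (((hasFDerivAt_coord j x).const_mul 2).mul (hasFDerivAt_oseenJ hn ht le_rfl x)) i).trans ?_
  simp [EuclideanSpace.inner_single_right, @eq_comm _ j i]
  split_ifs <;> ring

theorem Kmat_eq (hn : 2 ≤ n) {t : ℝ} (ht : 0 < t) (i j : Fin n) (x : Euc n) :
    Kmat n i j x t = (if i = j then 1 else 0) *
        ((2 - 2 * n) * oseenJ n 1 (‖x‖ ^ 2) t + 4 * ‖x‖ ^ 2 * oseenJ n 2 (‖x‖ ^ 2) t)
      - 4 * x i * x j * oseenJ n 2 (‖x‖ ^ 2) t := by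
  have hlap : lap n (fun y => genPhi n y t) x =
      2 * n * oseenJ n 1 (‖x‖ ^ 2) t - 4 * ‖x‖ ^ 2 * oseenJ n 2 (‖x‖ ^ 2) t := by
    simp only [lap, pd_pd_genPhi hn ht, if_true, Finset.sum_sub_distrib, Finset.sum_const,
      Finset.card_univ, Fintype.card_fin, ← Finset.sum_mul, nsmul_eq_mul]
    rw [EuclideanSpace.real_norm_sq_eq, Finset.mul_sum]
    congr 1
    · ring
    · congr 1
      exact Finset.sum_congr rfl fun k _ => by ring
  rw [Kmat, hlap, pd_pd_genPhi hn ht]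
  split_ifs <;> ring

/-- Explicit form of the third order kernel. -/
def oseenK (n : ℕ) (i j k : Fin n) (x : Euc n) (t : ℝ) : ℝ :=
  (if i = j then 1 else 0) * ((4 * n + 4) * x k * oseenJ n 2 (‖x‖ ^ 2) t
      - 8 * ‖x‖ ^ 2 * x k * oseenJ n 3 (‖x‖ ^ 2) t)
    - 4 * ((if i = k then 1 else 0) * x j + (if j = k then 1 else 0) * x i)
      * oseenJ n 2 (‖x‖ ^ 2) t
    + 8 * x i * x j * x k * oseenJ n 3 (‖x‖ ^ 2) t

theorem Kten_eq_oseenK (hn : 2 ≤ n) {t : ℝ} (ht : 0 < t) (i j k : Fin n) (x : Euc n) :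
    Kten n i j k x t = oseenK n i j k x t := by
  have h2 := hasFDerivAt_oseenJ hn ht one_le_two x
  have hN : HasFDerivAt (fun y : Euc n => ‖y‖ ^ 2) ((1 : ℝ) • ((2 : ℝ) • innerSL ℝ x)) x :=
    hasFDerivAt_comp_norm_sq (hasDerivAt_id _)
  rw [Kten, funext fun y => Kmat_eq hn ht i j y, oseenK]
  generalize (if i = j then (1 : ℝ) else 0) = δ
  refine (pd_eq_of_hasFDerivAt
    (((((hasFDerivAt_oseenJ hn ht le_rfl x).const_mul (2 - 2 * (n : ℝ))).add
      ((hN.const_mul 4).mul h2)).const_mul _).sub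
      ((((hasFDerivAt_coord i x).const_mul 4).mul (hasFDerivAt_coord j x)).mul h2)) k).trans ?_
  simp [EuclideanSpace.inner_single_right]
  split_ifs <;> ring

end OseenKernel

section OseenIntegrability

variable {n : ℕ}

theorem integrable_indicator_rpow_prod (T : ℝ) :
    Integrable ({q : ℝ × ℝ | (0 < q.1 ∧ q.1 < T) ∧ q.1 < q.2}.indicator
      fun q : ℝ × ℝ => q.2 ^ (-(3 / 2) : ℝ)) := by
  set A : Set (ℝ × ℝ) := {q : ℝ × ℝ | (0 < q.1 ∧ q.1 < T) ∧ q.1 < q.2}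
  have hA : MeasurableSet A :=
    ((measurableSet_lt measurable_const measurable_fst).inter
      (measurableSet_lt measurable_fst measurable_const)).inter
        (measurableSet_lt measurable_fst measurable_snd)
  have hs : ∀ t ∈ Set.Ioo 0 T, (fun s => A.indicator (fun q : ℝ × ℝ => q.2 ^ (-(3 / 2) : ℝ)) (t, s)) =
      (Set.Ioi t).indicator fun s => s ^ (-(3 / 2) : ℝ) := fun t ht => by
    ext s
    simp [A, Set.indicator_apply, ht.1, ht.2]
  have hs0 : ∀ t ∉ Set.Ioo 0 T, (fun s => A.indicator (fun q : ℝ × ℝ => q.2 ^ (-(3 / 2) : ℝ)) (t, s)) =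
      fun _ => 0 := fun t ht => by
    ext s
    exact Set.indicator_of_notMem (fun h => ht h.1) _
  rw [Measure.volume_eq_prod, integrable_prod_iff
    ((Measurable.indicator (by fun_prop) hA).aestronglyMeasurable)]
  refine ⟨ae_of_all _ fun t => ?_, ?_⟩
  · by_cases ht : t ∈ Set.Ioo 0 T
    · rw [hs t ht, integrable_indicator_iff measurableSet_Ioi]
      exact integrableOn_Ioi_rpow_of_lt (by norm_num) ht.1
    · rw [hs0 t ht]
      exact integrable_zero _ _ _
  · have e : (fun t => ∫ s, ‖A.indicator (fun q : ℝ × ℝ => q.2 ^ (-(3 / 2) : ℝ)) (t, s)‖) =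
        (Set.Ioo 0 T).indicator fun t => 2 * t ^ (-(1 / 2) : ℝ) := by
      ext t
      by_cases ht : t ∈ Set.Ioo 0 T
      · rw [Set.indicator_of_mem ht]
        calc _ = ∫ s, (Set.Ioi t).indicator (fun s => s ^ (-(3 / 2) : ℝ)) s := by
              refine integral_congr_ae (ae_of_all _ fun s => ?_)
              have := congrFun (hs t ht) s
              simp only at this ⊢
              rw [this, Real.norm_of_nonneg]
              exact Set.indicator_nonneg (fun s hs => rpow_nonneg (ht.1.trans hs).le _) s
          _ = _ := by
              rw [integral_indicator measurableSet_Ioi, integral_Ioi_rpow_of_lt (by norm_num) ht.1]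
              norm_num
              ring
      · rw [Set.indicator_of_notMem ht]
        calc _ = ∫ _ : ℝ, (0 : ℝ) := by
              refine integral_congr_ae (ae_of_all _ fun s => ?_)
              have := congrFun (hs0 t ht) s
              simp only at this ⊢
              rw [this, norm_zero]
          _ = 0 := by simp
    rw [e, integrable_indicator_iff measurableSet_Ioo]
    refine Integrable.const_mul ?_ 2
    by_cases hT : 0 ≤ T
    · have h := intervalIntegral.intervalIntegrable_rpow' (a := 0) (b := T) (r := -(1 / 2))
        (by norm_num)
      rw [intervalIntegrable_iff_integrableOn_Ioo_of_le hT] at h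
      exact h
    · rw [Set.Ioo_eq_empty (by linarith)]
      exact integrableOn_empty

theorem integrable_indicator_rpow_mul_heatKer (T : ℝ) :
    Integrable (fun p : (Euc n × ℝ) × ℝ =>
      {q : ℝ × ℝ | (0 < q.1 ∧ q.1 < T) ∧ q.1 < q.2}.indicator
        (fun q : ℝ × ℝ => q.2 ^ (-(3 / 2) : ℝ)) (p.1.2, p.2) * heatKer n p.1.1 (2 * p.2))
      ((volume.prod volume).prod volume) := by
  set a : ℝ × ℝ → ℝ := {q : ℝ × ℝ | (0 < q.1 ∧ q.1 < T) ∧ q.1 < q.2}.indicator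
    (fun q : ℝ × ℝ => q.2 ^ (-(3 / 2) : ℝ))
  have hai : Integrable a (volume.prod volume) := integrable_indicator_rpow_prod T
  have ha0 : ∀ q : ℝ × ℝ, ¬ 0 < q.2 → a q = 0 := fun q hq =>
    Set.indicator_of_notMem (fun h => hq (h.1.1.trans h.2)) _
  have h : Integrable (fun p : Euc n × (ℝ × ℝ) => a p.2 * heatKer n p.1 (2 * p.2.2))
      (volume.prod (volume.prod volume)) := by
    have hm : AEStronglyMeasurable (fun p : Euc n × (ℝ × ℝ) => a p.2 * heatKer n p.1 (2 * p.2.2))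
        (volume.prod (volume.prod volume)) :=
      hai.aestronglyMeasurable.comp_snd.mul (measurable_heatKer.comp
        (f := fun p : Euc n × (ℝ × ℝ) => (p.1, 2 * p.2.2)) (by fun_prop)).aestronglyMeasurable
    refine (integrable_prod_iff' hm).2 ⟨ae_of_all _ fun q => ?_, ?_⟩
    · by_cases hq : 0 < q.2
      · exact (integrable_heatKer (n := n) (s := 2 * q.2) (by positivity)).const_mul (a q)
      · simp only [ha0 q hq, zero_mul]
        exact integrable_zero _ _ _
    · refine hai.norm.congr (ae_of_all _ fun q => ?_)
      by_cases hq : 0 < q.2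
      · simp only [norm_mul]
        rw [integral_const_mul]
        have : ∀ x : Euc n, ‖heatKer n x (2 * q.2)‖ = heatKer n x (2 * q.2) := fun x =>
          Real.norm_of_nonneg (heatKer_pos x (by positivity)).le
        simp only [this]
        rw [integral_heatKer (by positivity), mul_one]
      · simp [ha0 q hq]
  exact (measurePreserving_prodAssoc (volume : Measure (Euc n)) (volume : Measure ℝ)
    (volume : Measure ℝ)).integrable_comp_of_integrable h

theorem gaussWeight_two_mul {s : ℝ} (hs : 0 < s) :
    gaussWeight n s = 2 ^ ((n : ℝ) / 2) * gaussWeight n (2 * s) := by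
  rw [gaussWeight, gaussWeight, show 4 * π * (2 * s) = 2 * (4 * π * s) by ring,
    mul_rpow zero_le_two (by positivity), ← mul_assoc, ← rpow_add two_pos]
  have : (n : ℝ) / 2 + -n / 2 = 0 := by ring
  rw [this, rpow_zero, one_mul]

theorem inv_sqrt_four_mul_pow_three {s : ℝ} (hs : 0 < s) :
    (√(4 * s))⁻¹ ^ 3 = 8⁻¹ * s ^ (-(3 / 2) : ℝ) := by
  have h : s ^ (-(3 / 2) : ℝ) = (√s)⁻¹ ^ 3 := by
    rw [sqrt_eq_rpow, ← rpow_neg hs.le, ← rpow_natCast, ← rpow_mul hs.le]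
    norm_num
  have h4 : √4 = 2 := by
    rw [show (4 : ℝ) = 2 ^ 2 by norm_num, sqrt_sq zero_le_two]
  rw [h, sqrt_mul zero_le_four, h4, mul_inv, mul_pow]
  norm_num

theorem integrable_indicator_mul_oseenJ {q : Euc n → ℝ} (hq : Measurable q) {m : ℕ} {B : ℝ}
    (hB : ∀ (x : Euc n) (w : ℝ), 0 ≤ w → |q x| * w ^ (2 * m) ≤ B * w ^ 3 * exp ((‖x‖ * w) ^ 2 / 2))
    (T : ℝ) :
    Integrable (fun p : Euc n × ℝ =>
      (Set.Ioo 0 T).indicator (fun t => q p.1 * oseenJ n m (‖p.1‖ ^ 2) t) p.2) := by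
  set A : Set (ℝ × ℝ) := {q : ℝ × ℝ | (0 < q.1 ∧ q.1 < T) ∧ q.1 < q.2}
  have hA : MeasurableSet A :=
    ((measurableSet_lt measurable_const measurable_fst).inter
      (measurableSet_lt measurable_fst measurable_const)).inter
        (measurableSet_lt measurable_fst measurable_snd)
  let F : (Euc n × ℝ) × ℝ → ℝ := fun p => {p : (Euc n × ℝ) × ℝ | (p.1.2, p.2) ∈ A}.indicator
    (fun p => q p.1.1 * (((4 * p.2)⁻¹ ^ m * gaussWeight n p.2) *
      exp (-(‖p.1.1‖ ^ 2 / (4 * p.2))))) p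
  have hFm : Measurable F := by
    refine Measurable.indicator ?_ (hA.preimage (by fun_prop))
    exact (hq.comp (by fun_prop)).mul ((Measurable.mul (by fun_prop)
      (measurable_gaussWeight.comp measurable_snd)).mul (by fun_prop))
  have hF : Integrable F ((volume.prod volume).prod volume) := by
    refine ((integrable_indicator_rpow_mul_heatKer T).const_mul
      (B * 8⁻¹ * 2 ^ ((n : ℝ) / 2))).mono' hFm.aestronglyMeasurable (ae_of_all _ fun p => ?_)
    by_cases hp : (p.1.2, p.2) ∈ A
    · have hs : 0 < p.2 := hp.1.1.trans hp.2
      have h1 : F p = q p.1.1 * (((4 * p.2)⁻¹ ^ m * gaussWeight n p.2) *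
        exp (-(‖p.1.1‖ ^ 2 / (4 * p.2)))) := Set.indicator_of_mem (by exact hp) _
      have h2 := hB p.1.1 (√(4 * p.2))⁻¹ (by positivity)
      have hw : (√(4 * p.2))⁻¹ ^ 2 = (4 * p.2)⁻¹ := by
        rw [inv_pow, sq_sqrt (by positivity)]
      rw [inv_sqrt_four_mul_pow_three hs, pow_mul, mul_pow, hw] at h2
      have h0 := gaussWeight_pos (n := n) (s := 2 * p.2) (by positivity)
      rw [h1, Set.indicator_of_mem hp, gaussWeight_two_mul hs, norm_mul, Real.norm_eq_abs,
        Real.norm_of_nonneg (by positivity), heatKer_eq]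
      calc |q p.1.1| * ((4 * p.2)⁻¹ ^ m * (2 ^ ((n : ℝ) / 2) * gaussWeight n (2 * p.2)) *
            exp (-(‖p.1.1‖ ^ 2 / (4 * p.2))))
          = (|q p.1.1| * (4 * p.2)⁻¹ ^ m) * (2 ^ ((n : ℝ) / 2) * gaussWeight n (2 * p.2) *
            exp (-(‖p.1.1‖ ^ 2 / (4 * p.2)))) := by ring
        _ ≤ (B * (8⁻¹ * p.2 ^ (-(3 / 2) : ℝ)) * exp (‖p.1.1‖ ^ 2 * (4 * p.2)⁻¹ / 2)) *
            (2 ^ ((n : ℝ) / 2) * gaussWeight n (2 * p.2) *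
            exp (-(‖p.1.1‖ ^ 2 / (4 * p.2)))) := by gcongr
        _ = (B * 8⁻¹ * 2 ^ ((n : ℝ) / 2)) * (p.2 ^ (-(3 / 2) : ℝ) * (gaussWeight n (2 * p.2) *
            (exp (‖p.1.1‖ ^ 2 * (4 * p.2)⁻¹ / 2) * exp (-(‖p.1.1‖ ^ 2 / (4 * p.2)))))) := by ring
        _ = _ := by
            rw [← exp_add]
            congr 5
            field_simp
            ring
    · have h1 : F p = 0 := Set.indicator_of_notMem (by exact hp) _
      rw [h1, Set.indicator_of_notMem hp]
      simp
  refine hF.integral_prod_left.congr (ae_of_all _ fun p => ?_)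
  simp only
  by_cases hp : p.2 ∈ Set.Ioo 0 T
  · rw [Set.indicator_of_mem hp, oseenJ, ← integral_const_mul, ← integral_indicator measurableSet_Ioi]
    refine integral_congr_ae (ae_of_all _ fun s => ?_)
    simp [F, A, Set.indicator_apply, hp.1, hp.2]
  · rw [Set.indicator_of_notMem hp]
    refine (integral_congr_ae (ae_of_all _ fun s => ?_)).trans (integral_zero _ _)
    exact Set.indicator_of_notMem (fun h => hp h.1) _

/-- The third order kernel, cut off to the time interval `(0, T)`. -/
def oseenCut (n : ℕ) (T : ℝ) (i j k : Fin n) (p : Euc n × ℝ) : ℝ :=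
  (Set.Ioo 0 T).indicator (Kten n i j k p.1) p.2

theorem integrable_oseenCut (hn : 2 ≤ n) (T : ℝ) (i j k : Fin n) :
    Integrable (oseenCut n T i j k) := by
  have hle : ∀ (x : Euc n) (l : Fin n), |x l| ≤ ‖x‖ := fun x l => by
    simpa using PiLp.norm_apply_le x l
  have hexp : ∀ y : ℝ, 1 + y ^ 2 / 2 + y ^ 4 / 8 ≤ exp (y ^ 2 / 2) := fun y => by
    have := quadratic_le_exp_of_nonneg (x := y ^ 2 / 2) (by positivity)
    linarith
  have h2 : ∀ l : Fin n, Integrable (fun p : Euc n × ℝ =>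
      (Set.Ioo 0 T).indicator (fun t => p.1 l * oseenJ n 2 (‖p.1‖ ^ 2) t) p.2) := fun l => by
    refine integrable_indicator_mul_oseenJ (B := 1) (q := fun x => x l) (by fun_prop)
      (fun x w hw => ?_) T
    calc |x l| * w ^ (2 * 2) ≤ ‖x‖ * w ^ (2 * 2) := by gcongr; exact hle x l
      _ = 1 * w ^ 3 * (‖x‖ * w) := by ring
      _ ≤ _ := by
        gcongr
        nlinarith [hexp (‖x‖ * w), sq_nonneg (‖x‖ * w - 1), sq_nonneg ((‖x‖ * w) ^ 2)]
  have h3 : ∀ q : Euc n → ℝ, Measurable q → (∀ x, |q x| ≤ ‖x‖ ^ 3) →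
      Integrable (fun p : Euc n × ℝ =>
        (Set.Ioo 0 T).indicator (fun t => q p.1 * oseenJ n 3 (‖p.1‖ ^ 2) t) p.2) := by
    intro q hq hqb
    refine integrable_indicator_mul_oseenJ (B := 8) hq (fun x w hw => ?_) T
    calc |q x| * w ^ (2 * 3) ≤ ‖x‖ ^ 3 * w ^ (2 * 3) := by gcongr; exact hqb x
      _ = w ^ 3 * (‖x‖ * w) ^ 3 := by ring
      _ ≤ w ^ 3 * (8 * exp ((‖x‖ * w) ^ 2 / 2)) := by
        gcongr
        nlinarith [hexp (‖x‖ * w), mul_nonneg (sq_nonneg (‖x‖ * w)) (sq_nonneg (‖x‖ * w - 1)),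
          sq_nonneg ((‖x‖ * w) ^ 2), sq_nonneg (‖x‖ * w)]
      _ = _ := by ring
  have ha := h3 (fun x => ‖x‖ ^ 2 * x k) (by fun_prop) fun x => by
    rw [abs_mul, abs_of_nonneg (by positivity), pow_succ]
    exact mul_le_mul_of_nonneg_left (hle x k) (by positivity)
  have hb := h3 (fun x => x i * x j * x k) (by fun_prop) fun x => by
    rw [abs_mul, abs_mul, pow_succ, sq]
    gcongr <;> exact hle x _
  refine (((((h2 k).const_mul (4 * n + 4)).sub (ha.const_mul 8)).const_mul
    (if i = j then 1 else 0)).sub ((((h2 j).const_mul (if i = k then 1 else 0)).add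
    ((h2 i).const_mul (if j = k then 1 else 0))).const_mul 4)).add (hb.const_mul 8) |>.congr
    (ae_of_all _ fun p => ?_)
  by_cases hp : p.2 ∈ Set.Ioo 0 T
  · simp only [Pi.add_apply, Pi.sub_apply, oseenCut, Set.indicator_of_mem hp,
      Kten_eq_oseenK hn hp.1, oseenK]
    ring
  · simp [oseenCut, Set.indicator_of_notMem hp]

end OseenIntegrability

section Duhamel

variable {n : ℕ}

/-- The quadratic term of the Navier–Stokes equations, cut off to the time interval `(0, T)`. -/
def quadCut (n : ℕ) (T : ℝ) (u : Euc n → ℝ → Euc n) (j k : Fin n) (q : Euc n × ℝ) : ℝ :=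
  (Set.Ioo 0 T).indicator (fun s => u q.1 s k * u q.1 s j) q.2

theorem measurable_quadCut {T : ℝ} {u : Euc n → ℝ → Euc n}
    (hu : Measurable fun q : Euc n × ℝ => u q.1 q.2) (j k : Fin n) :
    Measurable (quadCut n T u j k) := by
  have h : ∀ l : Fin n, Measurable fun q : Euc n × ℝ => u q.1 q.2 l := fun l =>
    (by fun_prop : Measurable fun y : Euc n => y l).comp hu
  exact ((h k).mul (h j)).indicator (measurableSet_Ioo.preimage measurable_snd)

theorem abs_quadCut_le {T C : ℝ} {u : Euc n → ℝ → Euc n}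
    (hb : ∀ x, ∀ t ∈ Set.Ioo 0 T, ‖u x t‖ ≤ C) (j k : Fin n) (q : Euc n × ℝ) :
    |quadCut n T u j k q| ≤ C ^ 2 := by
  by_cases hq : q.2 ∈ Set.Ioo 0 T
  · have h : ∀ l : Fin n, |u q.1 q.2 l| ≤ C := fun l =>
      (PiLp.norm_apply_le (u q.1 q.2) l).trans (hb _ _ hq)
    rw [quadCut, Set.indicator_of_mem hq, abs_mul, sq]
    gcongr
    · exact (abs_nonneg _).trans (h k)
    · exact h k
    · exact h j
  · rw [quadCut, Set.indicator_of_notMem hq, abs_zero]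
    exact sq_nonneg C

instance isAddHaarMeasure_volume_euc_prod :
    (volume : Measure (Euc n × ℝ)).IsAddHaarMeasure := by
  rw [Measure.volume_eq_prod]
  infer_instance

theorem integrable_oseenCut_mul_quadCut (hn : 2 ≤ n) {T T' C : ℝ} {u : Euc n → ℝ → Euc n}
    (hu : Measurable fun q : Euc n × ℝ => u q.1 q.2)
    (hb : ∀ x, ∀ t ∈ Set.Ioo 0 T, ‖u x t‖ ≤ C) (i j k : Fin n) (p : Euc n × ℝ) :
    Integrable fun q => oseenCut n T' i j k (p - q) * quadCut n T u j k q :=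
  ((integrable_oseenCut hn T' i j k).comp_sub_left p).mul_bdd (c := C ^ 2)
    (measurable_quadCut hu j k).aestronglyMeasurable
    (ae_of_all _ fun q => abs_quadCut_le hb j k q)

/-- The Duhamel term as a space-time convolution. -/
theorem duhamel_eq (hn : 2 ≤ n) {T T' C : ℝ} {u : Euc n → ℝ → Euc n}
    (hu : Measurable fun q : Euc n × ℝ => u q.1 q.2)
    (hb : ∀ x, ∀ t ∈ Set.Ioo 0 T, ‖u x t‖ ≤ C) (i : Fin n) (x : Euc n) {t : ℝ}
    (htT : t ≤ T) (htT' : t ≤ T') :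
    ∫ s in Set.Ioo 0 t, ∫ y : Euc n,
      ∑ j : Fin n, ∑ k : Fin n, Kten n i j k (x - y) (t - s) * u y s k * u y s j =
    ∑ j : Fin n, ∑ k : Fin n, ∫ q, oseenCut n T' i j k ((x, t) - q) * quadCut n T u j k q := by
  have hi := fun j k : Fin n =>
    integrable_oseenCut_mul_quadCut (T' := T') hn hu hb i j k (x, t)
  have hs := integrable_finsetSum Finset.univ fun j _ =>
    integrable_finsetSum Finset.univ fun k _ => hi j k
  simp_rw [← integral_finsetSum Finset.univ fun k _ => hi _ k]
  rw [← integral_finsetSum Finset.univ fun j _ =>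
    integrable_finsetSum Finset.univ fun k _ => hi j k, Measure.volume_eq_prod,
    integral_prod_symm _ hs]
  refine Eq.trans ?_ (setIntegral_eq_integral_of_forall_compl_eq_zero (s := Set.Ioo 0 t) ?_)
  · refine setIntegral_congr_fun measurableSet_Ioo fun s hs => ?_
    have h1 : t - s ∈ Set.Ioo 0 T' := ⟨by linarith [hs.2], by linarith [hs.1]⟩
    have h2 : s ∈ Set.Ioo 0 T := ⟨hs.1, by linarith [hs.2]⟩
    simp [oseenCut, quadCut, h1, h2, mul_assoc]
  · intro s hs
    refine (integral_congr_ae (ae_of_all _ fun y => ?_)).trans (integral_zero _ _)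
    refine Finset.sum_eq_zero fun j _ => Finset.sum_eq_zero fun k _ => ?_
    by_cases h1 : 0 < s
    · have h2 : t - s ∉ Set.Ioo 0 T' := fun h => hs ⟨h1, by linarith [h.1]⟩
      simp [oseenCut, h2]
    · have h2 : s ∉ Set.Ioo 0 T := fun h => h1 h.1
      simp [quadCut, h2]

theorem tendsto_integral_norm_oseenCut (hn : 2 ≤ n) (i j k : Fin n) :
    Tendsto (fun t : ℝ => ∫ p, ‖oseenCut n t i j k p‖) (𝓝[>] 0) (𝓝 0) := by
  have h := tendsto_integral_filter_of_dominated_convergence (μ := (volume : Measure (Euc n × ℝ)))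
    (l := 𝓝[>] (0 : ℝ)) (F := fun t p => ‖oseenCut n t i j k p‖) (f := fun _ => 0)
    (fun p => ‖oseenCut n 1 i j k p‖)
    (Eventually.of_forall fun t => (integrable_oseenCut hn t i j k).norm.aestronglyMeasurable)
    ?_ (integrable_oseenCut hn 1 i j k).norm (ae_of_all _ fun p => ?_)
  · simpa using h
  · filter_upwards [Ioo_mem_nhdsGT one_pos] with t ht
    refine ae_of_all _ fun p => ?_
    rw [norm_norm]
    exact norm_indicator_le_of_subset (Set.Ioo_subset_Ioo_right ht.2.le) _ _
  · refine tendsto_const_nhds.congr' ?_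
    simp only [oseenCut]
    by_cases hp : 0 < p.2
    · filter_upwards [Ioo_mem_nhdsGT hp] with t ht
      rw [Set.indicator_of_notMem (fun h => not_lt.2 ht.2.le h.2), norm_zero]
    · refine Eventually.of_forall fun t => ?_
      have h : p.2 ∉ Set.Ioo 0 t := fun h => hp h.1
      simp [h]

end Duhamel

section HeatSemigroup

variable {n : ℕ}

theorem sqrt_pow_mul_heatKer_smul {t : ℝ} (ht : 0 < t) (x : Euc n) :
    √t ^ n * heatKer n (√t • x) t = heatKer n x 1 := by
  have h : √t ^ n = t ^ ((n : ℝ) / 2) := by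
    rw [sqrt_eq_rpow, ← rpow_natCast, ← rpow_mul ht.le]
    congr 1
    ring
  have h2 : t ^ ((n : ℝ) / 2) * t ^ (-(n : ℝ) / 2) = 1 := by
    rw [← rpow_add ht, neg_div, add_neg_cancel, rpow_zero]
  have h3 : ‖√t • x‖ ^ 2 / (4 * t) = ‖x‖ ^ 2 / (4 * 1) := by
    rw [norm_smul, mul_pow, norm_of_nonneg (sqrt_nonneg t), sq_sqrt ht.le]
    field_simp
  rw [heatKer_eq, heatKer_eq, h3, gaussWeight_eq ht, gaussWeight_eq one_pos, h, one_rpow]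
  linear_combination (4 * π) ^ (-(n : ℝ) / 2) * exp (-(‖x‖ ^ 2 / (4 * 1))) * h2

theorem integral_heatKer_mul_eq {t : ℝ} (ht : 0 < t) (A : Euc n → ℝ) :
    ∫ x, heatKer n x t * A x = ∫ x, heatKer n x 1 * A (√t • x) := by
  have h := Measure.integral_comp_smul (volume : Measure (Euc n))
    (fun x => heatKer n x t * A x) √t
  have h0 : 0 < √t ^ n := by positivity
  simp only [finrank_euclideanSpace, Fintype.card_fin, abs_inv, abs_of_pos h0, smul_eq_mul] at h
  simp_rw [← sqrt_pow_mul_heatKer_smul ht, mul_assoc]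
  rw [integral_const_mul, h, mul_inv_cancel_left₀ h0.ne']

theorem tendsto_integral_heatKer_mul {A : Euc n → ℝ} (hA : Continuous A) {B : ℝ}
    (hB : ∀ x, |A x| ≤ B) :
    Tendsto (fun t => ∫ x, heatKer n x t * A x) (𝓝[>] 0) (𝓝 (A 0)) := by
  have h := tendsto_integral_filter_of_dominated_convergence (μ := (volume : Measure (Euc n)))
    (l := 𝓝[>] (0 : ℝ)) (F := fun t x => heatKer n x 1 * A (√t • x))
    (f := fun x => heatKer n x 1 * A 0)
    (fun x => heatKer n x 1 * B)
    (Eventually.of_forall fun t => ((continuous_heatKer 1).mul (by fun_prop)).aestronglyMeasurable)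
    (Eventually.of_forall fun t => ae_of_all _ fun x => ?_)
    ((integrable_heatKer one_pos).mul_const B) (ae_of_all _ fun x => ?_)
  · rw [integral_mul_const, integral_heatKer one_pos, one_mul] at h
    refine h.congr' ?_
    filter_upwards [self_mem_nhdsWithin] with t ht
    exact (integral_heatKer_mul_eq ht A).symm
  · have hk := heatKer_pos x one_pos
    rw [norm_mul, norm_of_nonneg hk.le]
    gcongr
    exact hB _
  · refine Tendsto.const_mul _ ?_
    have hc : Continuous fun t : ℝ => A (√t • x) := by fun_prop
    have := (hc.tendsto 0).mono_left (nhdsWithin_le_nhds (s := Set.Ioi 0))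
    simpa using this

/-- The heat semigroup converges weakly-* to its bounded initial datum. -/
theorem tendsto_integral_mul_heat {f g : Euc n → ℝ} (hf : Measurable f) {B : ℝ}
    (hB : ∀ x, |f x| ≤ B) (hg : Integrable g) :
    Tendsto (fun t => ∫ x, g x * ∫ y, heatKer n (x - y) t * f y) (𝓝[>] 0)
      (𝓝 (∫ x, g x * f x)) := by
  have hB0 : 0 ≤ B := (abs_nonneg _).trans (hB 0)
  obtain ⟨ℓ, hℓ, hℓ'⟩ := exists_clm_integral_mul (μ := (volume : Measure (Euc n)))
    (f := fun x => f (-x)) (hf.comp measurable_neg).aestronglyMeasurable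
    (fun x => hB _) hB0 (fun h hh => abs_integral_mul_le (fun x => hB _) hh)
  let A : Euc n → ℝ := fun z => ℓ (hg.comp_sub_left z).toL1
  have hA : ∀ z, A z = ∫ x, g x * f (x - z) := fun z => by
    rw [show A z = _ from hℓ' _ _,
      ← integral_sub_left_eq_self (fun x => g x * f (x - z)) volume z]
    simp
  have hAc : Continuous A := ℓ.continuous.comp (continuous_toL1_comp_sub_left hg)
  have hAb : ∀ z, |A z| ≤ B * ∫ x, ‖g x‖ := fun z => by
    rw [hA]
    exact abs_integral_mul_le (fun x => hB _) hg
  have h := tendsto_integral_heatKer_mul hAc hAb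
  rw [hA 0] at h
  simp only [sub_zero] at h
  refine h.congr' ?_
  filter_upwards [self_mem_nhdsWithin] with t ht
  have hswap : Integrable (fun p : Euc n × Euc n => g p.1 * heatKer n p.2 t * f (p.1 - p.2))
      (volume.prod volume) :=
    (hg.mul_prod (integrable_heatKer ht)).mul_bdd (c := B)
      (hf.comp (by fun_prop)).aestronglyMeasurable (ae_of_all _ fun p => hB _)
  calc ∫ z, heatKer n z t * A z = ∫ z, ∫ x, g x * heatKer n z t * f (x - z) := by
        refine integral_congr_ae (ae_of_all _ fun z => ?_)
        simp only [hA]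
        rw [← integral_const_mul]
        exact integral_congr_ae (ae_of_all _ fun x => by ring)
    _ = ∫ x, ∫ z, g x * heatKer n z t * f (x - z) := (integral_integral_swap hswap).symm
    _ = _ := by
        refine integral_congr_ae (ae_of_all _ fun x => ?_)
        simp only
        rw [← integral_sub_left_eq_self (fun y => heatKer n (x - y) t * f y) volume x,
          ← integral_const_mul]
        exact integral_congr_ae (ae_of_all _ fun z => by simp; ring)

/-- The heat kernel as a curve in `L¹`. -/
def heatL1 (n : ℕ) (p : Euc n × ℝ) : Lp ℝ 1 (volume : Measure (Euc n)) :=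
  if h : 0 < p.2 then (integrable_heatKer_sub h p.1).toL1 else 0

theorem continuousOn_heatL1 : ContinuousOn (heatL1 n) (Set.univ ×ˢ Set.Ioi 0) := by
  rintro ⟨x₀, t₀⟩ ⟨-, ht₀⟩
  rw [Set.mem_Ioi] at ht₀
  have hev : ∀ᶠ p : Euc n × ℝ in 𝓝 (x₀, t₀), ‖p.1 - x₀‖ < 1 ∧ t₀ / 2 < p.2 ∧ p.2 < 2 * t₀ := by
    have h1 : ∀ᶠ x in 𝓝 x₀, ‖x - x₀‖ < 1 := by
      simp only [← dist_eq_norm]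
      exact Metric.ball_mem_nhds x₀ one_pos
    have h2 : ∀ᶠ t in 𝓝 t₀, t₀ / 2 < t ∧ t < 2 * t₀ :=
      Ioo_mem_nhds (by linarith) (by linarith)
    exact h1.prod_nhds h2
  refine ContinuousAt.continuousWithinAt ?_
  rw [ContinuousAt, tendsto_iff_norm_sub_tendsto_zero]
  have hlim := tendsto_integral_filter_of_dominated_convergence (μ := (volume : Measure (Euc n)))
    (l := 𝓝 (x₀, t₀)) (F := fun p y => ‖heatKer n (p.1 - y) p.2 - heatKer n (x₀ - y) t₀‖)
    (f := fun _ => 0)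
    (fun y => gaussWeight n (t₀ / 2) * exp (1 / (8 * t₀)) / gaussWeight n (4 * t₀) *
      heatKer n (x₀ - y) (4 * t₀) + heatKer n (x₀ - y) t₀) ?_ ?_ ?_ ?_
  · rw [integral_zero] at hlim
    refine hlim.congr' ?_
    filter_upwards [hev] with p hp
    have hp0 : 0 < p.2 := lt_trans (by positivity) hp.2.1
    rw [heatL1, heatL1, dif_pos hp0, dif_pos ht₀, ← Integrable.toL1_sub,
      L1.norm_of_fun_eq_integral_norm]
    rfl
  · refine Eventually.of_forall fun p => Continuous.aestronglyMeasurable ?_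
    exact (((continuous_heatKer p.2).comp (by fun_prop)).sub
      ((continuous_heatKer t₀).comp (by fun_prop))).norm
  · filter_upwards [hev] with p hp
    refine ae_of_all _ fun y => ?_
    have hp0 : 0 < p.2 := lt_trans (by positivity) hp.2.1
    rw [norm_norm]
    refine (norm_sub_le _ _).trans ?_
    rw [norm_of_nonneg (heatKer_pos _ hp0).le, norm_of_nonneg (heatKer_pos _ ht₀).le]
    gcongr
    have hw := gaussWeight_pos (n := n) (s := 4 * t₀) (by positivity)
    have hsq : ‖x₀ - y‖ ^ 2 / 2 - 1 ≤ ‖p.1 - y‖ ^ 2 := by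
      have : ‖x₀ - y‖ ≤ ‖p.1 - x₀‖ + ‖p.1 - y‖ := by
        rw [norm_sub_rev p.1 x₀]
        exact norm_sub_le_norm_sub_add_norm_sub x₀ p.1 y
      have h2 : ‖x₀ - y‖ ≤ 1 + ‖p.1 - y‖ := by linarith [hp.1]
      nlinarith [norm_nonneg (x₀ - y), norm_nonneg (p.1 - y), sq_nonneg (‖p.1 - y‖ - 1)]
    have hexp : -(‖p.1 - y‖ ^ 2 / (4 * p.2)) ≤
        1 / (8 * t₀) + -(‖x₀ - y‖ ^ 2 / (4 * (4 * t₀))) := by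
      have h1 : ‖p.1 - y‖ ^ 2 / (4 * (2 * t₀)) ≤ ‖p.1 - y‖ ^ 2 / (4 * p.2) := by
        gcongr
        exact hp.2.2.le
      have h2 : (‖x₀ - y‖ ^ 2 / 2 - 1) / (4 * (2 * t₀)) ≤ ‖p.1 - y‖ ^ 2 / (4 * (2 * t₀)) := by
        gcongr
      have h3 : (‖x₀ - y‖ ^ 2 / 2 - 1) / (4 * (2 * t₀)) =
          ‖x₀ - y‖ ^ 2 / (4 * (4 * t₀)) - 1 / (8 * t₀) := by
        field_simp
        ring
      linarith
    calc heatKer n (p.1 - y) p.2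
        ≤ gaussWeight n (t₀ / 2) * exp (1 / (8 * t₀) + -(‖x₀ - y‖ ^ 2 / (4 * (4 * t₀)))) := by
          rw [heatKer_eq]
          gcongr
          · exact (gaussWeight_pos (by positivity)).le
          · exact gaussWeight_anti (by positivity) hp.2.1.le
      _ = _ := by
          rw [exp_add, heatKer_eq, div_mul_eq_mul_div, eq_div_iff hw.ne']
          ring
  · exact ((integrable_heatKer_sub (by positivity) x₀).const_mul _).add
      (integrable_heatKer_sub ht₀ x₀)
  · refine ae_of_all _ fun y => ?_
    have hc : ContinuousAt (fun p : Euc n × ℝ => heatKer n (p.1 - y) p.2) (x₀, t₀) := by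
      unfold heatKer
      refine ContinuousAt.mul (ContinuousAt.rpow_const (by fun_prop) (Or.inl (by positivity)))
        (ContinuousAt.rexp (ContinuousAt.div (by fun_prop) (by fun_prop) (by positivity)))
    have := (hc.tendsto.sub_const (heatKer n (x₀ - y) t₀)).norm
    simpa using this

end HeatSemigroup

section Compactness

variable {n : ℕ}

/-- A mild solution bounded by `C` has initial datum bounded by `C`, in the dual of `L¹`. -/
theorem abs_integral_mul_initial_le (hn : 2 ≤ n) {T C B : ℝ} (hT : 0 < T) {u : Euc n → ℝ → Euc n}
    {u₀ : Euc n → Euc n} (hu : Measurable fun q : Euc n × ℝ => u q.1 q.2) (hu₀ : Measurable u₀)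
    (hB : ∀ x, ‖u₀ x‖ ≤ B) (hb : ∀ x, ∀ t ∈ Set.Ioo 0 T, ‖u x t‖ ≤ C)
    (hmild : IsMildNS n 0 T u₀ u) (i : Fin n) {g : Euc n → ℝ} (hg : Integrable g) :
    |∫ x, g x * u₀ x i| ≤ C * ∫ x, ‖g x‖ := by
  have hlim := (tendsto_integral_mul_heat (f := fun x => u₀ x i)
    ((by fun_prop : Measurable fun y : Euc n => y i).comp hu₀)
    (fun x => (PiLp.norm_apply_le (u₀ x) i).trans (hB x)) hg).abs
  let ε : ℝ → ℝ := fun t => ∑ j : Fin n, ∑ k : Fin n, C ^ 2 * ∫ p, ‖oseenCut n t i j k p‖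
  have hε : Tendsto ε (𝓝[>] 0) (𝓝 0) := by
    have h := tendsto_finsetSum Finset.univ fun j _ => tendsto_finsetSum Finset.univ fun k _ =>
      (tendsto_integral_norm_oseenCut hn i j k).const_mul (C ^ 2)
    simpa [ε] using h
  have hbound := (hε.const_add C).mul_const (∫ x, ‖g x‖)
  rw [add_zero] at hbound
  refine le_of_tendsto_of_tendsto hlim hbound ?_
  filter_upwards [Ioo_mem_nhdsGT hT] with t ht
  refine abs_integral_mul_le (fun x => ?_) hg
  have hm := hmild x t ht i
  rw [duhamel_eq hn hu hb i x ht.2.le (by simp : t ≤ t)] at hm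
  simp only [sub_zero] at hm
  rw [sub_eq_iff_eq_add.1 hm.symm]
  refine (abs_add_le _ _).trans ?_
  refine add_le_add ((PiLp.norm_apply_le (u x t) i).trans (hb x t ht)) ?_
  refine (Finset.abs_sum_le_sum_abs _ _).trans (Finset.sum_le_sum fun j _ => ?_)
  refine (Finset.abs_sum_le_sum_abs _ _).trans (Finset.sum_le_sum fun k _ => ?_)
  refine (abs_integral_mul_le (fun q => abs_quadCut_le hb j k q)
    ((integrable_oseenCut hn t i j k).comp_sub_left (x, t))).trans_eq ?_
  rw [integral_sub_left_eq_self (fun p => ‖oseenCut n t i j k p‖) volume (x, t)]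

theorem tendstoLocallyUniformlyOn_euc {X : Type*} [TopologicalSpace X] {F : ℕ → X → Euc n}
    {f : X → Euc n} {s : Set X}
    (h : ∀ i, TendstoLocallyUniformlyOn (fun m q => F m q i) (fun q => f q i) atTop s) :
    TendstoLocallyUniformlyOn F f atTop s := by
  rw [tendstoLocallyUniformlyOn_iff_forall_tendsto]
  intro x hx
  rw [tendsto_uniformity_iff_dist_tendsto_zero]
  have h1 := fun i => tendsto_uniformity_iff_dist_tendsto_zero.1
    (tendstoLocallyUniformlyOn_iff_forall_tendsto.1 (h i) x hx)
  have h2 := (tendsto_finsetSum Finset.univ fun i _ => (h1 i).pow 2).sqrt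
  simpa [EuclideanSpace.dist_eq] using h2

theorem tendstoLocallyUniformlyOn_sum {X ι : Type*} [TopologicalSpace X] (S : Finset ι)
    {F : ι → ℕ → X → ℝ} {f : ι → X → ℝ} {s : Set X}
    (h : ∀ i, TendstoLocallyUniformlyOn (F i) (f i) atTop s) :
    TendstoLocallyUniformlyOn (fun m q => ∑ i ∈ S, F i m q) (fun q => ∑ i ∈ S, f i q) atTop s := by
  classical
  induction S using Finset.induction_on with
  | empty =>
    intro V hV x _
    exact ⟨Set.univ, univ_mem, Eventually.of_forall fun _ _ _ => by
      simpa using refl_mem_uniformity hV⟩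
  | insert a S ha ih =>
    simp only [Finset.sum_insert ha]
    exact (h a).add ih

/-- The map `q ↦ K(p - q)` as a curve in `L¹`. -/
def oseenL1 (hn : 2 ≤ n) (T : ℝ) (i j k : Fin n) (p : Euc n × ℝ) :
    Lp ℝ 1 (volume : Measure (Euc n × ℝ)) :=
  ((integrable_oseenCut hn T i j k).comp_sub_left p).toL1

theorem exists_dual_initial (hn : 2 ≤ n) {T C B : ℝ} (hT : 0 < T) (hC : 0 ≤ C)
    {u : Euc n → ℝ → Euc n}
    {u₀ : Euc n → Euc n} (hu : Measurable fun q : Euc n × ℝ => u q.1 q.2) (hu₀ : Measurable u₀)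
    (hB : ∀ x, ‖u₀ x‖ ≤ B) (hb : ∀ x, ∀ t ∈ Set.Ioo 0 T, ‖u x t‖ ≤ C)
    (hmild : IsMildNS n 0 T u₀ u) (i : Fin n) :
    ∃ ℓ : Lp ℝ 1 (volume : Measure (Euc n)) →L[ℝ] ℝ, ‖ℓ‖ ≤ C ∧
      ∀ (g : Euc n → ℝ) (hg : Integrable g), ℓ hg.toL1 = ∫ x, g x * u₀ x i :=
  exists_clm_integral_mul
    ((by fun_prop : Measurable fun y : Euc n => y i).comp hu₀).aestronglyMeasurable
    (fun x => (PiLp.norm_apply_le (u₀ x) i).trans (hB x)) hC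
    fun _ hg => abs_integral_mul_initial_le hn hT hu hu₀ hB hb hmild i hg

theorem exists_dual_quadCut {T C : ℝ} {u : Euc n → ℝ → Euc n}
    (hu : Measurable fun q : Euc n × ℝ => u q.1 q.2)
    (hb : ∀ x, ∀ t ∈ Set.Ioo 0 T, ‖u x t‖ ≤ C) (j k : Fin n) :
    ∃ ℓ : Lp ℝ 1 (volume : Measure (Euc n × ℝ)) →L[ℝ] ℝ, ‖ℓ‖ ≤ C ^ 2 ∧
      ∀ (g : Euc n × ℝ → ℝ) (hg : Integrable g), ℓ hg.toL1 = ∫ q, g q * quadCut n T u j k q :=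
  exists_clm_integral_mul (measurable_quadCut hu j k).aestronglyMeasurable
    (fun q => abs_quadCut_le hb j k q) (sq_nonneg C)
    fun _ hg => abs_integral_mul_le (fun q => abs_quadCut_le hb j k q) hg

/-- The mild formulation, written with functionals on `L¹`. -/
theorem isMildNS_iff (hn : 2 ≤ n) {T C : ℝ} {u : Euc n → ℝ → Euc n} {u₀ : Euc n → Euc n}
    (hu : Measurable fun q : Euc n × ℝ => u q.1 q.2)
    (hb : ∀ x, ∀ t ∈ Set.Ioo 0 T, ‖u x t‖ ≤ C)
    {ℓ : Fin n → (Lp ℝ 1 (volume : Measure (Euc n)) →L[ℝ] ℝ)}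
    {P : Fin n × Fin n → (Lp ℝ 1 (volume : Measure (Euc n × ℝ)) →L[ℝ] ℝ)}
    (hℓ : ∀ i (g : Euc n → ℝ) (hg : Integrable g), ℓ i hg.toL1 = ∫ x, g x * u₀ x i)
    (hP : ∀ i j k (p : Euc n × ℝ), P (j, k) (oseenL1 hn T i j k p) =
      ∫ q, oseenCut n T i j k (p - q) * quadCut n T u j k q) :
    IsMildNS n 0 T u₀ u ↔ ∀ x, ∀ t ∈ Set.Ioo 0 T, ∀ i, u x t i =
      ℓ i (heatL1 n (x, t)) - ∑ j, ∑ k, P (j, k) (oseenL1 hn T i j k (x, t)) := by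
  refine forall₄_congr fun x t ht i => ?_
  rw [duhamel_eq hn hu hb i x ht.2.le ht.2.le, heatL1, dif_pos ht.1, hℓ]
  simp only [hP, sub_zero]

theorem memLp_two_heatKer : MemLp (fun x : Euc n => heatKer n x 1) 2 := by
  have hm := (continuous_heatKer (n := n) 1).aestronglyMeasurable (μ := volume)
  rw [memLp_two_iff_integrable_sq hm]
  simp only [sq]
  refine (integrable_heatKer one_pos).mul_bdd (c := gaussWeight n 1) hm (ae_of_all _ fun x => ?_)
  rw [norm_of_nonneg (heatKer_pos x one_pos).le, heatKer_eq]
  refine mul_le_of_le_one_right (gaussWeight_pos one_pos).le (exp_le_one_iff.2 ?_)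
  have : 0 ≤ ‖x‖ ^ 2 / (4 * 1) := by positivity
  linarith

end Compactness

/-- Lemma 4.2 (compactness): a uniformly bounded sequence of mild solutions on
ℝⁿ × (0,T) has a subsequence converging locally uniformly to a mild solution whose
initial datum is the weak-* L^∞ limit of the corresponding initial data. -/
theorem ns_mild_compactness (n : ℕ) (hn : 2 ≤ n) (T : ℝ) (hT : 0 < T) (C : ℝ)
    (u : ℕ → Euc n → ℝ → Euc n) (u₀ : ℕ → Euc n → Euc n)
    (hmeas : ∀ k, Measurable (fun q : Euc n × ℝ => u k q.1 q.2))
    (hmeas0 : ∀ k, Measurable (u₀ k))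
    (hbd0 : ∀ k, ∃ B : ℝ, ∀ x : Euc n, ‖u₀ k x‖ ≤ B)
    (hbd : ∀ k, ∀ x : Euc n, ∀ t ∈ Set.Ioo (0:ℝ) T, ‖u k x t‖ ≤ C)
    (hmild : ∀ k, IsMildNS n 0 T (u₀ k) (u k)) :
    ∃ φ : ℕ → ℕ, StrictMono φ ∧
      ∃ (v : Euc n → ℝ → Euc n) (v₀ : Euc n → Euc n),
        Measurable (fun q : Euc n × ℝ => v q.1 q.2) ∧ Measurable v₀ ∧
        (∀ x : Euc n, ∀ t ∈ Set.Ioo (0:ℝ) T, ‖v x t‖ ≤ C) ∧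
        -- local uniform convergence in ℝⁿ × (0,T)
        TendstoLocallyUniformlyOn (fun m (q : Euc n × ℝ) => u (φ m) q.1 q.2)
          (fun q => v q.1 q.2) atTop (Set.univ ×ˢ Set.Ioo 0 T) ∧
        -- the initial data converge weakly-* in L^∞ to v₀
        (∀ g : Euc n → ℝ, Integrable g → ∀ i : Fin n,
          Tendsto (fun m => ∫ x : Euc n, g x * u₀ (φ m) x i) atTop
            (𝓝 (∫ x : Euc n, g x * v₀ x i))) ∧
        IsMildNS n 0 T v₀ v := by
  have hC : 0 ≤ C := (norm_nonneg _).trans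
    (hbd 0 0 (T / 2) ⟨by positivity, by linarith⟩)
  choose B hB using hbd0
  choose ℓ hℓC hℓ using fun m i => exists_dual_initial hn hT hC (hmeas m) (hmeas0 m) (hB m)
    (hbd m) (hmild m) i
  choose P hPC hP using fun m (a : Fin n × Fin n) =>
    exists_dual_quadCut (hmeas m) (hbd m) a.1 a.2
  have : Fact ((1 : ENNReal) ≠ ⊤) := ⟨ENNReal.one_ne_top⟩
  obtain ⟨φ₁, hφ₁, L, hLC, hL⟩ := exists_subseq_tendsto_dual ℓ hC hℓC
  obtain ⟨φ₂, hφ₂, Q, hQC, hQ⟩ := exists_subseq_tendsto_dual (fun m => P (φ₁ m))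
    (sq_nonneg C) (fun m a => hPC _ a)
  set φ : ℕ → ℕ := fun m => φ₁ (φ₂ m)
  replace hL : ∀ i g, Tendsto (fun m => ℓ (φ m) i g) atTop (𝓝 (L i g)) := fun i g =>
    (hL i g).comp hφ₂.tendsto_atTop
  have hu : ∀ m x, ∀ t ∈ Set.Ioo (0 : ℝ) T, ∀ i, u m x t i =
      ℓ m i (heatL1 n (x, t)) - ∑ j, ∑ k, P m (j, k) (oseenL1 hn T i j k (x, t)) := fun m =>
    (isMildNS_iff hn (hmeas m) (hbd m) (hℓ m) fun i j k p => hP m (j, k) _ _).1 (hmild m)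
  let w : Fin n → Euc n × ℝ → ℝ := fun i p =>
    L i (heatL1 n p) - ∑ j, ∑ k, Q (j, k) (oseenL1 hn T i j k p)
  have hw : ∀ i, TendstoLocallyUniformlyOn (fun m (q : Euc n × ℝ) => u (φ m) q.1 q.2 i) (w i)
      atTop (Set.univ ×ˢ Set.Ioo 0 T) := by
    intro i
    have h1 := tendstoLocallyUniformlyOn_dual_comp (fun m => hℓC (φ m) i) (hLC i) (hL i)
      ((continuousOn_heatL1 (n := n)).mono
        (Set.prod_mono_right (t₁ := Set.Ioo 0 T) fun t ht => ht.1))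
    have h2 := fun j k => tendstoLocallyUniformlyOn_dual_comp (s := Set.univ ×ˢ Set.Ioo 0 T)
      (fun m => hPC (φ m) (j, k)) (hQC (j, k)) (hQ (j, k))
      (continuous_toL1_comp_sub_left (integrable_oseenCut hn T i j k)).continuousOn
    refine (h1.sub (tendstoLocallyUniformlyOn_sum Finset.univ fun j =>
      tendstoLocallyUniformlyOn_sum Finset.univ fun k => h2 j k)).congr fun m q hq => ?_
    exact (hu (φ m) q.1 q.2 hq.2 i).symm
  let v : Euc n → ℝ → Euc n := fun x t =>
    (Set.Ioo 0 T).indicator (fun t => WithLp.toLp 2 fun i => w i (x, t)) t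
  have hv : ∀ x, ∀ t ∈ Set.Ioo 0 T, ∀ i, v x t i = w i (x, t) := fun x t ht i => by
    simp only [v, Set.indicator_of_mem ht]
  have huv : TendstoLocallyUniformlyOn (fun m (q : Euc n × ℝ) => u (φ m) q.1 q.2)
      (fun q => v q.1 q.2) atTop (Set.univ ×ˢ Set.Ioo 0 T) :=
    tendstoLocallyUniformlyOn_euc fun i => (hw i).congr_right fun q hq =>
      (hv q.1 q.2 hq.2 i).symm
  have hlim : ∀ x, ∀ t ∈ Set.Ioo (0 : ℝ) T, Tendsto (fun m => u (φ m) x t) atTop (𝓝 (v x t)) :=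
    fun x t ht => huv.tendsto_at (a := (x, t)) ⟨Set.mem_univ _, ht⟩
  have hvm : Measurable fun q : Euc n × ℝ => v q.1 q.2 := by
    refine measurable_of_tendsto_metrizable (f := fun m (q : Euc n × ℝ) =>
      (Set.Ioo 0 T).indicator (fun t => u (φ m) q.1 t) q.2)
      (fun m => (hmeas (φ m)).indicator (measurableSet_Ioo.preimage measurable_snd))
      (tendsto_pi_nhds.2 fun q => ?_)
    by_cases hq : q.2 ∈ Set.Ioo 0 T
    · simpa only [Set.indicator_of_mem hq] using hlim q.1 q.2 hq
    · simp only [v, Set.indicator_of_notMem hq]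
      exact tendsto_const_nhds
  have hvC : ∀ x, ∀ t ∈ Set.Ioo (0 : ℝ) T, ‖v x t‖ ≤ C := fun x t ht =>
    le_of_tendsto (hlim x t ht).norm (Eventually.of_forall fun m => hbd _ x t ht)
  choose v₀ hv₀m hv₀C hv₀ using fun i => exists_bdd_repr_dual_L1 (L i) (hLC i)
    memLp_two_heatKer (continuous_heatKer 1).measurable fun x => heatKer_pos x one_pos
  refine ⟨φ, hφ₁.comp hφ₂, v, fun x => WithLp.toLp 2 fun i => v₀ i x, hvm, ?_, hvC, huv,
    fun g hg i => ?_, ?_⟩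
  · exact (MeasurableEquiv.toLp 2 (Fin n → ℝ)).measurable.comp (measurable_pi_lambda _ hv₀m)
  · have h := hL i hg.toL1
    simp only [hℓ] at h
    rwa [hv₀] at h
  · refine (isMildNS_iff hn hvm hvC (u₀ := fun x => WithLp.toLp 2 fun i => v₀ i x)
      (fun i g hg => hv₀ i g hg) (fun i j k p => ?_)).2 fun x t ht i => hv x t ht i
    refine tendsto_nhds_unique (hQ (j, k) (oseenL1 hn T i j k p)) ?_
    have hK := (integrable_oseenCut hn T i j k).comp_sub_left p
    simp only [oseenL1, hP]
    refine tendsto_integral_of_dominated_convergence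
      (fun q => ‖oseenCut n T i j k (p - q)‖ * C ^ 2)
      (fun m => hK.aestronglyMeasurable.mul (measurable_quadCut (hmeas _) j k).aestronglyMeasurable)
      (hK.norm.mul_const _) (fun m => ae_of_all _ fun q => ?_) (ae_of_all _ fun q => ?_)
    · rw [norm_mul]
      gcongr
      exact abs_quadCut_le (hbd _) j k q
    · refine Tendsto.const_mul _ ?_
      by_cases hq : q.2 ∈ Set.Ioo 0 T
      · have h : ∀ l : Fin n, Tendsto (fun m => u (φ m) q.1 q.2 l) atTop (𝓝 (v q.1 q.2 l)) :=
          fun l => ((EuclideanSpace.proj l : Euc n →L[ℝ] ℝ).continuous.tendsto _).comp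
            (hlim q.1 q.2 hq)
        simpa only [quadCut, Set.indicator_of_mem hq] using (h k).mul (h j)
      · simp only [quadCut, Set.indicator_of_notMem hq]
        exact tendsto_const_nhds

end
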